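/- Under hypotheses (H1), (H2) and (H3), the sequence of measures ν_n converges in the weak* topology to a probability measure ν which is g-invariant, ergodic, and is the unique measure maximizing the entropy of g: h_ν(g) = h_top(g), and any g-invariant probability measure η with h_η(g) = h_top(g) equals ν. -/

import Mathlib

open MeasureTheory Filter Topology Set
open scoped ENNReal NNReal

namespace Samva

variable {X : Type*}

/-- The `n`-th iterate (`n : ℤ`) of a homeomorphism. -/
noncomputable def zIter [TopologicalSpace X] (f : X ≃ₜ X) : ℤ → X → X
  | Int.ofNat n => (f : X → X)^[n]
  | Int.negSucc n => (f.symm : X → X)^[n + 1]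

/-- `f` is expansive with expansivity constant `α`. -/
def IsExpansiveWith [PseudoMetricSpace X] (f : X ≃ₜ X) (α : ℝ) : Prop :=
  0 < α ∧ ∀ x y : X, (∀ n : ℤ, dist (zIter f n x) (zIter f n y) ≤ α) → x = y

/-- `f` is expansive. -/
def IsExpansive [PseudoMetricSpace X] (f : X ≃ₜ X) : Prop :=
  ∃ α : ℝ, IsExpansiveWith f α

/-- The (periodic) specification property. -/
def HasSpecification [PseudoMetricSpace X] (f : X ≃ₜ X) : Prop :=
  ∀ ε : ℝ, 0 < ε → ∃ M : ℕ, ∀ (k : ℕ) (x : Fin (k + 1) → X) (a b : Fin (k + 1) → ℤ),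
    (∀ i, a i ≤ b i) →
    (∀ i : Fin k, (M : ℤ) ≤ a i.succ - b i.castSucc) →
    ∀ p : ℤ, (M : ℤ) + b (Fin.last k) - a 0 ≤ p →
      ∃ z : X, zIter f p z = z ∧
        ∀ i, ∀ j : ℤ, a i ≤ j → j ≤ b i → dist (zIter f j z) (zIter f j (x i)) ≤ ε

/-- The set of `n`-periodic points. -/
def perSet (f : X → X) (n : ℕ) : Set X := {x | f^[n] x = x}

/-- The uniform (equidistributed) probability measure on the `n`-periodic points of `f`,
`μ_n = |Per_n(f)|⁻¹ ∑_{x ∈ Per_n(f)} δ_x`. -/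
noncomputable def perMeasure [MeasurableSpace X] (f : X → X) (n : ℕ) : Measure X :=
  ProbabilityTheory.uniformOn (perSet f n)

/-- The uniform probability measure on a set `s`,
`|s|⁻¹ ∑_{x ∈ s} δ_x`. -/
noncomputable def unifMeasure [MeasurableSpace X] (s : Set X) : Measure X :=
  ProbabilityTheory.uniformOn s

/-- Weak* convergence of a sequence of measures against continuous test functions. -/
def WeakLimit [TopologicalSpace X] [MeasurableSpace X] (μs : ℕ → Measure X) (ν : Measure X) :
    Prop :=
  ∀ φ : C(X, ℝ), Tendsto (fun n => ∫ x, φ x ∂(μs n)) atTop (𝓝 (∫ x, φ x ∂ν))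

/-- `ν` is a weak* accumulation point of the sequence `μs`. -/
def WeakClusterPt [TopologicalSpace X] [MeasurableSpace X] (μs : ℕ → Measure X)
    (ν : Measure X) : Prop :=
  ∃ u : ℕ → ℕ, StrictMono u ∧ WeakLimit (μs ∘ u) ν

/-- `E` is `(n,ε)`-separated for `g`. -/
def IsSep [PseudoMetricSpace X] (g : X → X) (n : ℕ) (ε : ℝ) (E : Set X) : Prop :=
  E.Pairwise fun x y => ∃ j < n, ε < dist (g^[j] x) (g^[j] y)

/-- Maximal cardinality of an `(n,ε)`-separated subset of `K` for `g`. -/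
noncomputable def sepCard [PseudoMetricSpace X] (g : X → X) (K : Set X) (n : ℕ) (ε : ℝ) :
    ℝ≥0∞ :=
  ⨆ (E : Finset X) (_ : ↑E ⊆ K ∧ IsSep g n ε ↑E), (E.card : ℝ≥0∞)

/-- Topological entropy of `g` relative to the set `K`:
`h_top(g,K) = lim_{ε→0} limsup_n (1/n) log E_K(n,ε)`; since the inner quantity is
monotone in `ε`, the limit as `ε → 0` is the supremum over `ε > 0`. -/
noncomputable def relEntropy [PseudoMetricSpace X] (g : X → X) (K : Set X) : EReal :=
  ⨆ (ε : ℝ) (_ : 0 < ε),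
    Filter.limsup (fun n : ℕ => ENNReal.log (sepCard g K n ε) / (n : EReal)) atTop

/-- Topological entropy of `g`. -/
noncomputable def topEntropy [PseudoMetricSpace X] (g : X → X) : EReal :=
  relEntropy g Set.univ

/-- A finite measurable partition of `X`. -/
def IsMPartition [MeasurableSpace X] (P : Finset (Set X)) : Prop :=
  (∀ A ∈ P, MeasurableSet A) ∧ ((P : Set (Set X)).PairwiseDisjoint id) ∧
    ⋃₀ (P : Set (Set X)) = Set.univ

/-- The entropy `H_μ(P ∨ g⁻¹P ∨ ⋯ ∨ g^{-(n-1)}P)` of the `n`-th dynamical refinement of the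
partition `P`. -/
noncomputable def dynH [MeasurableSpace X] (μ : Measure X) (g : X → X) (P : Finset (Set X))
    (n : ℕ) : ℝ :=
  ∑ A : Fin n → ↥P, Real.negMulLog (μ (⋂ i : Fin n, g^[i.1] ⁻¹' ((A i : Set X)))).toReal

/-- The measure-theoretic (Kolmogorov–Sinai) entropy `h_μ(g)`, using that for invariant `μ`
the limit `lim_n H_n/n` equals `inf_n H_n/n` by subadditivity. -/
noncomputable def mEntropy [MeasurableSpace X] (g : X → X) (μ : Measure X) : EReal :=
  ⨆ P : {P : Finset (Set X) // IsMPartition P},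
    ⨅ n : ℕ, ((dynH μ g (P : Finset (Set X)) (n + 1) / (n + 1) : ℝ) : EReal)

section Hyp

variable [MetricSpace X] [CompactSpace X] [MeasurableSpace X] [BorelSpace X]

/-- Hypothesis (H1): every class `[x] = h⁻¹(h x)` has zero relative topological entropy. -/
def HypH1 (g h : X → X) : Prop :=
  ∀ x : X, relEntropy g (h ⁻¹' {h x}) = 0

/-- Hypothesis (H2): every periodic class contains a `g`-periodic point whose `g`-period is
the `f`-period of `h x`. -/
def HypH2 (f g h : X → X) : Prop :=
  ∀ x : X, h x ∈ Function.periodicPts f →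
    ∃ y : X, h y = h x ∧ Function.minimalPeriod g y = Function.minimalPeriod f (h x)

/-- Hypothesis (H3): the set of points whose class is trivial has full Bowen measure. -/
def HypH3 (h : X → X) (μ : Measure X) : Prop :=
  μ {y : X | ∃ x : X, h ⁻¹' {y} = {x}} = 1

/-- `P` is an admissible choice of the sets `P̃er_n(g)`: `P n` consists of `g`-periodic points
of period `n` lying over `Per_n(f)`, and `h` maps `P n` bijectively onto `Per_n(f)`. -/
def IsPerSelection (f g h : X → X) (P : ℕ → Set X) : Prop :=
  ∀ n : ℕ, P n ⊆ perSet g n ∧ (∀ x ∈ P n, g x ∈ P n) ∧ Set.BijOn h (P n) (perSet f n)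

end Hyp

end Samva

open Samva


set_option linter.unusedVariables false
open MeasureTheory Filter Topology Set
open scoped ENNReal NNReal
open Samva

namespace SamvaAux

section Entropy

/-- finite-valued measurable function -/
def FM {X ι : Type*} [MeasurableSpace X] (a : X → ι) : Prop := ∀ i, MeasurableSet (a ⁻¹' {i})

noncomputable def Hf {X ι : Type*} [MeasurableSpace X] [Fintype ι] (μ : Measure X) (a : X → ι) : ℝ :=
  ∑ i, Real.negMulLog (μ.real (a ⁻¹' {i}))

/-- the n-th name -/
def nm {X ι : Type*} (g : X → X) (a : X → ι) (n : ℕ) : X → (Fin n → ι) := fun x i => a (g^[i.1] x)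

noncomputable def DH {X ι : Type*} [MeasurableSpace X] [Fintype ι] (μ : Measure X) (g : X → X)
    (a : X → ι) (n : ℕ) : ℝ := Hf μ (nm g a n)

variable {X : Type*} [MeasurableSpace X]

lemma FM.preimage {ι : Type*} [Finite ι] {a : X → ι} (ha : FM a) (s : Set ι) :
    MeasurableSet (a ⁻¹' s) := by
  have : a ⁻¹' s = ⋃ i ∈ s, a ⁻¹' {i} := by ext; simp
  rw [this]
  exact MeasurableSet.biUnion (Set.toFinite s).countable (fun i _ => ha i)

lemma FM.comp {ι κ : Type*} [Finite ι] {a : X → ι} (ha : FM a) (φ : ι → κ) : FM (φ ∘ a) := by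
  intro k; rw [Set.preimage_comp]; exact ha.preimage _

lemma FM.prod {ι κ : Type*} {a : X → ι} {b : X → κ} (ha : FM a) (hb : FM b) :
    FM (fun x => (a x, b x)) := by
  rintro ⟨i, j⟩
  have : (fun x => (a x, b x)) ⁻¹' {(i, j)} = a ⁻¹' {i} ∩ b ⁻¹' {j} := by ext; simp
  rw [this]; exact (ha i).inter (hb j)

lemma FM.pi {n : ℕ} {ι : Type*} {a : Fin n → X → ι} (ha : ∀ k, FM (a k)) :
    FM (fun x k => a k x) := by
  intro i
  have : (fun x k => a k x) ⁻¹' {i} = ⋂ k, a k ⁻¹' {i k} := by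
    ext x; simp [funext_iff]
  rw [this]; exact MeasurableSet.iInter (fun k => ha k _)

lemma FM.compMeas {ι : Type*} {a : X → ι} (ha : FM a) {Y : Type*} [MeasurableSpace Y] {g : Y → X} (hg : Measurable g) :
    FM (a ∘ g) := fun i => by rw [Set.preimage_comp]; exact hg (ha i)

lemma FM.nm {ι : Type*} {a : X → ι} (ha : FM a) {g : X → X} (hg : Measurable g) (n : ℕ) :
    FM (nm g a n) := FM.pi (fun k => ha.compMeas (hg.iterate k.1))

lemma sum_real_fiber {ι : Type*} [Fintype ι] (μ : Measure X) [IsFiniteMeasure μ] {a : X → ι}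
    (ha : FM a) (s : Finset ι) : ∑ i ∈ s, μ.real (a ⁻¹' {i}) = μ.real (a ⁻¹' s) := by
  have : a ⁻¹' (s : Set ι) = ⋃ i ∈ s, a ⁻¹' {i} := by ext; simp
  rw [this, measureReal_biUnion_finset]
  · intro i _ j _ hij
    exact Disjoint.preimage a (by simpa using hij)
  · intro i _; exact ha i

lemma sum_real_fiber_inter {ι : Type*} [Fintype ι] (μ : Measure X) [IsFiniteMeasure μ] {a : X → ι}
    (ha : FM a) {A : Set X} (hA : MeasurableSet A) : ∑ i, μ.real (a ⁻¹' {i} ∩ A) = μ.real A := by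
  have := sum_real_fiber (μ.restrict A) ha Finset.univ
  simp only [measureReal_restrict_apply (ha _)] at this
  rw [this]; simp

lemma jensen_neg {ι : Type*} (s : Finset ι) (p : ι → ℝ) (hp : ∀ i ∈ s, 0 ≤ p i) :
    ∑ i ∈ s, Real.negMulLog (p i) ≤ Real.negMulLog (∑ i ∈ s, p i) + (∑ i ∈ s, p i) * Real.log s.card := by
  set P := ∑ i ∈ s, p i with hP
  have hP0 : 0 ≤ P := Finset.sum_nonneg hp
  rcases hP0.eq_or_lt with h0 | h0
  · have hz : ∀ i ∈ s, p i = 0 := (Finset.sum_eq_zero_iff_of_nonneg hp).1 h0.symm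
    rw [← h0]; simp
    apply le_of_eq; apply Finset.sum_eq_zero; intro i hi; rw [hz i hi]; simp
  have hs : s.Nonempty := by
    by_contra h; rw [Finset.not_nonempty_iff_eq_empty] at h; simp [hP, h] at h0
  have hc : (0:ℝ) < s.card := by exact_mod_cast hs.card_pos
  have key : ∀ i ∈ s, Real.negMulLog (p i) ≤ P / s.card - p i + p i * (Real.log s.card - Real.log P) := by
    intro i hi
    rcases (hp i hi).eq_or_lt with h | h
    · rw [← h]; simp; positivity
    · have h1 := Real.log_le_sub_one_of_pos (x := P / s.card / p i) (by positivity)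
      rw [Real.log_div (by positivity) h.ne', Real.log_div h0.ne' hc.ne'] at h1
      have h2 := mul_le_mul_of_nonneg_left h1 h.le
      have h3 : p i * (P / s.card / p i - 1) = P / s.card - p i := by field_simp
      rw [h3] at h2
      unfold Real.negMulLog; nlinarith
  refine (Finset.sum_le_sum key).trans ?_
  rw [Finset.sum_add_distrib, Finset.sum_sub_distrib, ← Finset.sum_mul, ← hP]
  simp only [Finset.sum_const, nsmul_eq_mul]
  unfold Real.negMulLog
  have : (s.card : ℝ) * (P / s.card) = P := by field_simp
  rw [this]; apply le_of_eq; ring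

lemma neg_sum_le {ι : Type*} (s : Finset ι) (p : ι → ℝ) (hp : ∀ i ∈ s, 0 ≤ p i) :
    Real.negMulLog (∑ i ∈ s, p i) ≤ ∑ i ∈ s, Real.negMulLog (p i) := by
  unfold Real.negMulLog
  rw [← Finset.sum_neg_distrib, Finset.sum_mul]
  apply Finset.sum_le_sum
  intro i hi
  rcases (hp i hi).eq_or_lt with h | h
  · rw [← h]; simp
  · have h1 : p i ≤ ∑ i ∈ s, p i := Finset.single_le_sum hp hi
    have := Real.log_le_log h h1
    nlinarith

variable {ι κ : Type*} [Fintype ι] [Fintype κ]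

lemma Hf_nonneg (μ : Measure X) [IsProbabilityMeasure μ] (a : X → ι) : 0 ≤ Hf μ a :=
  Finset.sum_nonneg (fun i _ => Real.negMulLog_nonneg measureReal_nonneg measureReal_le_one)

lemma Hf_comp_le (μ : Measure X) [IsProbabilityMeasure μ] {a : X → ι} (ha : FM a) (φ : ι → κ) :
    Hf μ (φ ∘ a) ≤ Hf μ a := by
  classical
  unfold Hf
  have : ∀ k, Real.negMulLog (μ.real ((φ ∘ a) ⁻¹' {k})) ≤
      ∑ i ∈ Finset.univ.filter (fun i => φ i = k), Real.negMulLog (μ.real (a ⁻¹' {i})) := by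
    intro k
    have h1 : (φ ∘ a) ⁻¹' {k} = a ⁻¹' ((Finset.univ.filter (fun i => φ i = k) : Finset ι) : Set ι) := by
      ext; simp
    rw [h1, ← sum_real_fiber μ ha]
    exact neg_sum_le _ _ (fun _ _ => measureReal_nonneg)
  refine (Finset.sum_le_sum (fun k _ => this k)).trans (le_of_eq ?_)
  exact Finset.sum_fiberwise _ _ _

/-- multiplicity bound -/
lemma Hf_le_of_mult (μ : Measure X) [IsProbabilityMeasure μ] {a : X → ι} {b : X → κ} (ha : FM a)
    (hb : FM b) (N : ℕ) 
    (hN : ∀ j, ∃ s : Finset ι, s.card ≤ N ∧ ∀ x, b x = j → a x ∈ s) :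
    Hf μ a ≤ Hf μ b + Real.log N := by
  classical
  have h1 : Hf μ a ≤ Hf μ (fun x => (a x, b x)) := Hf_comp_le μ (ha.prod hb) Prod.fst
  refine h1.trans ?_
  unfold Hf
  rw [Fintype.sum_prod_type_right]
  have hsum : ∑ j, μ.real (b ⁻¹' {j}) = 1 := by
    rw [sum_real_fiber μ hb]; simp
  have key : ∀ j, ∑ i, Real.negMulLog (μ.real ((fun x => (a x, b x)) ⁻¹' {(i, j)})) ≤
      Real.negMulLog (μ.real (b ⁻¹' {j})) + μ.real (b ⁻¹' {j}) * Real.log N := by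
    intro j
    obtain ⟨s, hs, hs2⟩ := hN j
    have e1 : ∀ i, (fun x => (a x, b x)) ⁻¹' {(i, j)} = a ⁻¹' {i} ∩ b ⁻¹' {j} := by
      intro i; ext; simp
    simp only [e1]
    have e2 : ∀ i ∉ s, μ.real (a ⁻¹' {i} ∩ b ⁻¹' {j}) = 0 := by
      intro i hi
      have : a ⁻¹' {i} ∩ b ⁻¹' {j} = ∅ := by
        ext x; simp; rintro rfl h; exact hi (hs2 x h)
      rw [this]; simp
    have e3 : ∑ i ∈ s, μ.real (a ⁻¹' {i} ∩ b ⁻¹' {j}) = μ.real (b ⁻¹' {j}) := by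
      rw [← sum_real_fiber_inter μ ha (hb j)]
      exact Finset.sum_subset (Finset.subset_univ _) (fun i _ hi => e2 i hi)
    have e4 : ∑ i, Real.negMulLog (μ.real (a ⁻¹' {i} ∩ b ⁻¹' {j})) =
        ∑ i ∈ s, Real.negMulLog (μ.real (a ⁻¹' {i} ∩ b ⁻¹' {j})) := by
      symm
      refine Finset.sum_subset (Finset.subset_univ _) (fun i _ hi => ?_)
      rw [e2 i hi]; simp
    rw [e4]
    refine (jensen_neg s _ (fun _ _ => measureReal_nonneg)).trans ?_
    rw [e3]
    refine add_le_add le_rfl (mul_le_mul_of_nonneg_left ?_ measureReal_nonneg)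
    rcases Nat.eq_zero_or_pos s.card with h | h
    · rw [h]; simpa using Real.log_natCast_nonneg N
    · exact Real.log_le_log (by exact_mod_cast h) (by exact_mod_cast hs)
  refine (Finset.sum_le_sum (fun j _ => key j)).trans ?_
  rw [Finset.sum_add_distrib, ← Finset.sum_mul, hsum, one_mul]

lemma Hf_le_log_card (μ : Measure X) [IsProbabilityMeasure μ] {a : X → ι} (ha : FM a) :
    Hf μ a ≤ Real.log (Fintype.card ι) := by
  have := Hf_le_of_mult μ (b := fun _ : X => ()) ha (fun _ => by measurability) (Fintype.card ι)
    (fun j => ⟨Finset.univ, le_rfl, by simp⟩)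
  refine this.trans ?_
  simp [Hf]

/-- splitting bound -/
lemma Hf_split (μ : Measure X) [IsProbabilityMeasure μ] {a : X → ι} (ha : FM a) [DecidableEq ι] (s : Finset ι) :
    Hf μ a ≤ Real.log 2 + μ.real (a ⁻¹' s) * Real.log s.card
      + (1 - μ.real (a ⁻¹' s)) * Real.log (sᶜ.card) := by
  have h1 := jensen_neg s (fun i => μ.real (a ⁻¹' {i})) (fun _ _ => measureReal_nonneg)
  have h2 := jensen_neg sᶜ (fun i => μ.real (a ⁻¹' {i})) (fun _ _ => measureReal_nonneg)
  rw [sum_real_fiber μ ha] at h1 h2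
  have h3 : μ.real (a ⁻¹' ((sᶜ : Finset ι) : Set ι)) = 1 - μ.real (a ⁻¹' s) := by
    rw [Finset.coe_compl, Set.preimage_compl, measureReal_compl (ha.preimage _)]; simp
  rw [h3] at h2
  set t := μ.real (a ⁻¹' s)
  have h4 : Real.negMulLog t + Real.negMulLog (1 - t) ≤ Real.log 2 := by
    have := Real.binEntropy_le_log_two (p := t)
    rwa [Real.binEntropy_eq_negMulLog_add_negMulLog_one_sub] at this
  have : Hf μ a = _ := (Finset.sum_add_sum_compl s (fun i => Real.negMulLog (μ.real (a ⁻¹' {i})))).symm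
  rw [this]; linarith

lemma Hf_prod_le (μ : Measure X) [IsProbabilityMeasure μ] {a : X → ι} {b : X → κ} (ha : FM a) (hb : FM b) :
    Hf μ (fun x => (a x, b x)) ≤ Hf μ a + Hf μ b := by
  classical
  have e1 : ∀ i j, (fun x => (a x, b x)) ⁻¹' {(i, j)} = a ⁻¹' {i} ∩ b ⁻¹' {j} := by
    intro i j; ext; simp
  unfold Hf
  rw [Fintype.sum_prod_type]
  simp only [e1]
  set r : ι → κ → ℝ := fun i j => μ.real (a ⁻¹' {i} ∩ b ⁻¹' {j})
  set p : ι → ℝ := fun i => μ.real (a ⁻¹' {i})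
  set q : κ → ℝ := fun j => μ.real (b ⁻¹' {j})
  have hp : ∀ i, ∑ j, r i j = p i := by
    intro i
    have := sum_real_fiber_inter μ hb (ha i)
    simp only [Set.inter_comm] at this
    exact this
  have hq : ∀ j, ∑ i, r i j = q j := fun j => sum_real_fiber_inter μ ha (hb j)
  have hp1 : ∑ i, p i = 1 := by
    have := sum_real_fiber μ ha Finset.univ
    simpa using this
  have hq1 : ∑ i, q i = 1 := by
    have := sum_real_fiber μ hb Finset.univ
    simpa using this
  have key : ∀ i j, Real.negMulLog (r i j) ≤ p i * q j - r i j - r i j * Real.log (p i) - r i j * Real.log (q j) := by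
    intro i j
    have hr : 0 ≤ r i j := measureReal_nonneg
    have hrp : r i j ≤ p i := measureReal_mono inter_subset_left
    have hrq : r i j ≤ q j := measureReal_mono inter_subset_right
    rcases hr.eq_or_lt with h | h
    · rw [← h]; simp
      exact mul_nonneg (hr.trans hrp) (hr.trans hrq)
    · have hpp := h.trans_le hrp
      have hqp := h.trans_le hrq
      have h1 := Real.log_le_sub_one_of_pos (x := p i * q j / r i j) (by positivity)
      rw [Real.log_div (by positivity) h.ne', Real.log_mul hpp.ne' hqp.ne'] at h1
      have h2 := mul_le_mul_of_nonneg_left h1 h.le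
      have h3 : r i j * (p i * q j / r i j - 1) = p i * q j - r i j := by field_simp
      rw [h3] at h2
      unfold Real.negMulLog; nlinarith
  refine (Finset.sum_le_sum (fun i _ => Finset.sum_le_sum (fun j _ => key i j))).trans (le_of_eq ?_)
  simp only [Finset.sum_sub_distrib]
  have s1 : ∑ i, ∑ j, p i * q j = 1 := by
    simp only [← Finset.mul_sum, hq1, mul_one, hp1]
  have s2 : ∑ i, ∑ j, r i j = 1 := by simp only [hp, hp1]
  have s3 : ∑ i, ∑ j, r i j * Real.log (p i) = - ∑ i, Real.negMulLog (p i) := by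
    simp only [← Finset.sum_mul, hp, Real.negMulLog, ← Finset.sum_neg_distrib]
    congr 1; ext; ring
  have s4 : ∑ i, ∑ j, r i j * Real.log (q j) = - ∑ j, Real.negMulLog (q j) := by
    rw [Finset.sum_comm]
    simp only [← Finset.sum_mul, hq, Real.negMulLog, ← Finset.sum_neg_distrib]
    congr 1; ext; ring
  rw [s1, s2, s3, s4]; ring

lemma Hf_comp_mp {Y : Type*} [MeasurableSpace Y] (ν : Measure Y) {g : Y → X} (hg : Measurable g) {a : X → ι} (ha : FM a) :
    Hf ν (a ∘ g) = Hf (ν.map g) a := by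
  unfold Hf
  congr 1; ext i
  rw [map_measureReal_apply hg (ha i), Set.preimage_comp]

lemma Hf_pi_le (μ : Measure X) [IsProbabilityMeasure μ] {n : ℕ} {a : Fin n → X → ι} (ha : ∀ k, FM (a k)) :
    Hf μ (fun x k => a k x) ≤ ∑ k, Hf μ (a k) := by
  induction n with
  | zero =>
    have := Hf_le_log_card μ (FM.pi ha)
    simpa using this
  | succ n ih =>
    rw [Fin.sum_univ_castSucc]
    have h1 := ih (fun k => ha k.castSucc)
    have h2 := Hf_prod_le μ (FM.pi (fun k : Fin n => ha k.castSucc)) (ha (Fin.last n))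
    have h3 := Hf_comp_le μ ((FM.pi (fun k : Fin n => ha k.castSucc)).prod (ha (Fin.last n)))
      (fun p : (Fin n → ι) × ι => (Fin.snoc p.1 p.2 : Fin (n+1) → ι))
    have h4 : ((fun p : (Fin n → ι) × ι => (Fin.snoc p.1 p.2 : Fin (n+1) → ι)) ∘ 
      fun x => ((fun k : Fin n => a k.castSucc x), a (Fin.last n) x)) = fun x k => a k x := by
      funext x k
      refine Fin.lastCases ?_ (fun k => ?_) k <;> simp
    rw [h4] at h3
    linarith

lemma map_iterate_inv {μ : Measure X} {g : X → X} (hg : Measurable g) (hinv : μ.map g = μ) (n : ℕ) :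
    μ.map (g^[n]) = μ :=
  ((⟨hg, hinv⟩ : MeasurePreserving g μ μ).iterate n).map_eq

lemma Hf_iter {μ : Measure X} {g : X → X} (hg : Measurable g) (hinv : μ.map g = μ) {a : X → ι} (ha : FM a) (n : ℕ) :
    Hf μ (a ∘ g^[n]) = Hf μ a := by
  rw [Hf_comp_mp μ (hg.iterate n) ha, map_iterate_inv hg hinv]

lemma DH_le_mul {μ : Measure X} [IsProbabilityMeasure μ] {g : X → X} (hg : Measurable g) (hinv : μ.map g = μ) {a : X → ι} (ha : FM a) (n : ℕ) :
    DH μ g a n ≤ n * Hf μ a := by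
  have := Hf_pi_le μ (a := fun k : Fin n => a ∘ g^[k.1]) (fun k => ha.compMeas (hg.iterate k.1))
  refine this.trans (le_of_eq ?_)
  simp [Hf_iter hg hinv ha]

/-- names are functions of block names -/
lemma DH_mul_le {μ : Measure X} [IsProbabilityMeasure μ] {g : X → X} (hg : Measurable g) (hinv : μ.map g = μ) {a : X → ι} (ha : FM a) (k n : ℕ) :
    DH μ g a (k * n) ≤ k * DH μ g a n := by
  have hF : ∀ i : Fin k, FM (nm g a n ∘ g^[i.1 * n]) := fun i => (ha.nm hg n).compMeas (hg.iterate _)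
  have h1 := Hf_pi_le μ hF
  have h2 := Hf_comp_le μ (FM.pi hF) (fun (w : Fin k → Fin n → ι) (i : Fin (k * n)) => w i.divNat i.modNat)
  have h3 : ((fun (w : Fin k → Fin n → ι) (i : Fin (k * n)) => w i.divNat i.modNat) ∘ 
      fun x i => (nm g a n ∘ g^[i.1 * n]) x) = nm g a (k * n) := by
    funext x i
    simp only [Function.comp_apply, nm, ← Function.iterate_add_apply]
    congr 2
    exact Nat.mod_add_div' i.1 n
  rw [h3] at h2
  have h4 : ∀ i : Fin k, Hf μ (nm g a n ∘ g^[i.1 * n]) = DH μ g a n := fun i => Hf_iter hg hinv (ha.nm hg n) _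
  simp only [h4] at h1
  refine h2.trans (h1.trans (le_of_eq ?_))
  simp

end Entropy

end SamvaAux

set_option linter.unusedVariables false
open MeasureTheory Filter Topology Set
open scoped ENNReal NNReal
open Samva

namespace SamvaAux

section MEnt
universe u
variable {X : Type u} [MeasurableSpace X]

lemma exists_class (P : Finset (Set X)) (hP : IsMPartition P) :
    ∃ a : X → ↥P, (∀ x (A : ↥P), a x = A ↔ x ∈ (A : Set X)) ∧ FM a := by
  obtain ⟨h1, h2, h3⟩ := hP
  have : ∀ x, ∃ A : ↥P, x ∈ (A : Set X) := by
    intro x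
    have : x ∈ ⋃₀ (P : Set (Set X)) := by rw [h3]; trivial
    obtain ⟨A, hA, hx⟩ := this
    exact ⟨⟨A, hA⟩, hx⟩
  choose a ha using this
  have key : ∀ x (A : ↥P), a x = A ↔ x ∈ (A : Set X) := by
    intro x A
    constructor
    · rintro rfl; exact ha x
    · intro hx
      by_contra hne
      have hd := h2 (a x).2 A.2 (fun h => hne (Subtype.ext h))
      exact Set.disjoint_left.1 hd (ha x) hx
  refine ⟨a, key, fun A => ?_⟩
  have : a ⁻¹' {A} = (A : Set X) := by ext x; simp [key]
  rw [this]; exact h1 _ A.2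

lemma dynH_eq (μ : Measure X) (g : X → X) (P : Finset (Set X)) (a : X → ↥P)
    (ha : ∀ x (A : ↥P), a x = A ↔ x ∈ (A : Set X)) (n : ℕ) : dynH μ g P n = DH μ g a n := by
  unfold dynH DH Hf
  refine Finset.sum_congr rfl (fun A _ => ?_)
  have : nm g a n ⁻¹' {A} = ⋂ i : Fin n, g^[i.1] ⁻¹' ((A i : Set X)) := by
    ext x; simp [nm, funext_iff, ha]
  rw [this]; rfl

lemma mEntropy_le (μ : Measure X) (g : X → X) (c : ℝ)
    (hc : ∀ (ι : Type u) [Fintype ι] (a : X → ι), FM a → ∀ δ > 0, ∃ n : ℕ, 1 ≤ n ∧ DH μ g a n ≤ (c + δ) * n) :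
    mEntropy g μ ≤ c := by
  unfold mEntropy
  refine iSup_le ?_
  rintro ⟨P, hP⟩
  obtain ⟨a, ha, haF⟩ := exists_class P hP
  refine EReal.le_of_forall_lt_iff_le.1 ?_
  intro z hz
  have hz' : c < z := by exact_mod_cast hz
  obtain ⟨n, hn, hD⟩ := hc _ a haF (z - c) (by linarith)
  obtain ⟨m, rfl⟩ : ∃ m, n = m + 1 := ⟨n - 1, by omega⟩
  refine (iInf_le _ m).trans ?_
  rw [EReal.coe_le_coe_iff, div_le_iff₀ (by positivity), dynH_eq μ g P a ha]
  push_cast at hD ⊢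
  have : c + (z - c) = z := by ring
  rwa [this] at hD

lemma le_mEntropy (μ : Measure X) [IsProbabilityMeasure μ] (g : X → X) (hg : Measurable g) (c : ℝ) {ι : Type*} [Fintype ι]
    {a : X → ι} (haF : FM a) (hc : ∀ n : ℕ, 1 ≤ n → c * n ≤ DH μ g a n) :
    (c : EReal) ≤ mEntropy g μ := by
  classical
  set P : Finset (Set X) := Finset.univ.image (fun i => a ⁻¹' {i}) with hPdef
  have hP : IsMPartition P := by
    refine ⟨?_, ?_, ?_⟩
    · intro A hA
      obtain ⟨i, -, rfl⟩ := Finset.mem_image.1 hA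
      exact haF i
    · intro A hA B hB hAB
      obtain ⟨i, -, rfl⟩ := Finset.mem_image.1 (Finset.mem_coe.1 hA)
      obtain ⟨j, -, rfl⟩ := Finset.mem_image.1 (Finset.mem_coe.1 hB)
      refine Disjoint.preimage a ?_
      simp only [Set.disjoint_singleton]
      rintro rfl; exact hAB rfl
    · ext x; simp only [Set.mem_univ, iff_true]
      exact ⟨a ⁻¹' {a x}, by simp [hPdef], rfl⟩
  obtain ⟨b, hb, hbF⟩ := exists_class P hP
  haveI : Nonempty ι := by
    have : Nonempty X := (inferInstance : NeZero μ).1 |> fun h => by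
      by_contra hX
      rw [not_nonempty_iff] at hX
      exact h (Measure.eq_zero_of_isEmpty μ)
    exact this.map a
  have : ∃ φ : ↥P → ι, a = φ ∘ b := by
    refine ⟨fun A => if hA : ∃ x, x ∈ (A : Set X) then a hA.choose else Classical.arbitrary ι, ?_⟩
    funext x
    have hx : x ∈ (b x : Set X) := (hb x _).1 rfl
    have hex : ∃ y, y ∈ (b x : Set X) := ⟨x, hx⟩
    simp only [Function.comp_apply]
    rw [dif_pos hex]
    obtain ⟨i, -, hi⟩ := Finset.mem_image.1 (b x).2
    have h1 := hex.choose_spec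
    rw [← hi] at hx
    have h2 : hex.choose ∈ a ⁻¹' {i} := by rw [hi]; exact h1
    rw [hx, h2]
  obtain ⟨φ, hφ⟩ := this
  refine le_trans ?_ (le_iSup _ ⟨P, hP⟩)
  refine le_iInf (fun n => ?_)
  rw [EReal.coe_le_coe_iff, le_div_iff₀ (by positivity), dynH_eq μ g P b hb]
  have h1 := hc (n+1) (by omega)
  have h2 : DH μ g a (n+1) ≤ DH μ g b (n+1) := by
    have := Hf_comp_le μ (hbF.nm hg (n+1)) (fun (w : Fin (n+1) → ↥P) i => φ (w i))
    rw [show (fun (w : Fin (n+1) → ↥P) i => φ (w i)) ∘ nm g b (n+1) = nm g a (n+1) from by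
      funext x i; simp [nm, hφ]] at this
    exact this
  push_cast at h1
  linarith

lemma exists_DH_le (μ : Measure X) [IsProbabilityMeasure μ] (g : X → X) (hg : Measurable g) (hinv : μ.map g = μ) (c : ℝ)
    (h : mEntropy g μ ≤ c) {ι : Type*} [Fintype ι] {a : X → ι} (haF : FM a) (δ : ℝ) (hδ : 0 < δ) (N0 : ℕ) :
    ∃ n : ℕ, 1 ≤ n ∧ N0 ≤ n ∧ DH μ g a n ≤ (c + δ) * n := by
  by_contra hcon
  push Not at hcon
  have : ((c + δ : ℝ) : EReal) ≤ mEntropy g μ := by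
    refine le_mEntropy μ g hg _ haF ?_
    intro n hn
    by_contra hlt
    push Not at hlt
    have h1 := hcon ((N0 + 1) * n) (by nlinarith) (by nlinarith)
    have h2 := DH_mul_le hg hinv haF (N0+1) n
    push_cast at h1 h2
    have : (0:ℝ) < N0 + 1 := by positivity
    nlinarith
  have h3 := this.trans h
  rw [EReal.coe_le_coe_iff] at h3
  linarith

end MEnt

section Sep
variable {X : Type*} [PseudoMetricSpace X]

lemma IsSep.mono {g : X → X} {n : ℕ} {ε ε' : ℝ} {E : Set X} (h : IsSep g n ε E) (hε : ε' ≤ ε) : IsSep g n ε' E :=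
  fun x hx y hy hxy => by
    obtain ⟨j, hj, hd⟩ := h hx hy hxy
    exact ⟨j, hj, hε.trans_lt hd⟩

/-- uniform bound on the cardinality of separated sets -/
lemma exists_sep_bound [CompactSpace X] {g : X → X} (hg : Continuous g) (n : ℕ) {ε : ℝ} (hε : 0 < ε) :
    ∃ N : ℕ, ∀ E : Finset X, IsSep g n ε ↑E → E.card ≤ N := by
  classical
  let B : X → Set X := fun x => ⋂ j ∈ Finset.range n, {y | dist (g^[j] y) (g^[j] x) < ε / 2}
  have hB : ∀ x, IsOpen (B x) := by
    intro x
    refine isOpen_biInter_finset (fun j _ => ?_)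
    exact isOpen_lt ((hg.iterate j).dist continuous_const) continuous_const
  have hxB : ∀ x, x ∈ B x := by
    intro x; simp [B, hε]
  obtain ⟨t, ht⟩ := isCompact_univ.elim_finite_subcover B hB (fun x _ => mem_iUnion.2 ⟨x, hxB x⟩)
  refine ⟨t.card, fun E hE => ?_⟩
  have : ∀ x, ∃ y ∈ t, x ∈ B y := by
    intro x
    have := ht (mem_univ x)
    simpa using this
  choose c hc1 hc2 using this
  refine Finset.card_le_card_of_injOn c (fun x _ => hc1 x) ?_
  intro x hx y hy hxy
  by_contra hne
  obtain ⟨j, hj, hd⟩ := hE hx hy hne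
  have h1 := hc2 x
  have h2 := hc2 y
  rw [← hxy] at h2
  simp only [B, mem_iInter, Finset.mem_range, mem_setOf_eq] at h1 h2
  have h3 := h1 j hj
  have h4 := h2 j hj
  have := dist_triangle_right (g^[j] x) (g^[j] y) (g^[j] (c x))
  linarith

lemma exists_max_sep [CompactSpace X] {g : X → X} (hg : Continuous g) (K : Set X) (n : ℕ) {ε : ℝ} (hε : 0 < ε) :
    ∃ E : Finset X, ↑E ⊆ K ∧ IsSep g n ε ↑E ∧ sepCard g K n ε = E.card ∧
      (∀ E' : Finset X, ↑E' ⊆ K → IsSep g n ε ↑E' → E'.card ≤ E.card) ∧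
      ∀ x ∈ K, ∃ e ∈ E, ∀ j < n, dist (g^[j] x) (g^[j] e) ≤ ε := by
  classical
  obtain ⟨N, hN⟩ := exists_sep_bound hg n hε
  set S : Set ℕ := {k | ∃ E : Finset X, (↑E ⊆ K ∧ IsSep g n ε ↑E) ∧ E.card = k} with hS
  have hSne : S.Nonempty := ⟨0, ∅, ⟨by simp, by simp [IsSep]⟩, rfl⟩
  have hSb : BddAbove S := ⟨N, by rintro k ⟨E, ⟨-, h⟩, rfl⟩; exact hN E h⟩
  obtain ⟨E, ⟨hEK, hEs⟩, hEc⟩ := Nat.sSup_mem hSne hSb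
  have hmax : ∀ E' : Finset X, ↑E' ⊆ K → IsSep g n ε ↑E' → E'.card ≤ E.card := by
    intro E' h1 h2
    rw [hEc]; exact le_csSup hSb ⟨E', ⟨h1, h2⟩, rfl⟩
  refine ⟨E, hEK, hEs, ?_, hmax, ?_⟩
  · apply le_antisymm
    · refine iSup₂_le (fun E' h => ?_)
      exact_mod_cast hmax E' h.1 h.2
    · exact le_iSup₂_of_le E ⟨hEK, hEs⟩ le_rfl
  · intro x hx
    by_contra hcon
    push Not at hcon
    have hxE : x ∉ E := by
      intro h
      obtain ⟨j, _, hj⟩ := hcon x h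
      rw [dist_self] at hj; linarith
    have := hmax (insert x E) (by simp [Set.insert_subset_iff, hx, hEK]) ?_
    · rw [Finset.card_insert_of_notMem hxE] at this; omega
    · rw [Finset.coe_insert]
      intro a ha b hb hab
      rcases ha with rfl | ha <;> rcases hb with rfl | hb
      · exact absurd rfl hab
      · exact hcon b hb
      · obtain ⟨j, h1, h2⟩ := hcon a ha
        exact ⟨j, h1, by rwa [dist_comm]⟩
      · exact hEs ha hb hab

end Sep

section Adapted
variable {X : Type*} [MetricSpace X] [MeasurableSpace X] [BorelSpace X]

/-- adapted partition around a maximal separated set -/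
lemma exists_adapted {g : X → X} (hg : Continuous g) (n : ℕ) {ε : ℝ} 
    (E : Finset X) (hE : IsSep g n ε ↑E) (hspan : ∀ x, ∃ e ∈ E, ∀ j < n, dist (g^[j] x) (g^[j] e) ≤ ε) :
    ∃ b : X → ↥E, FM b ∧ (∀ x, ∀ j < n, dist (g^[j] x) (g^[j] (b x : X)) ≤ ε) ∧
      ∀ x (e : ↥E), (∀ j < n, dist (g^[j] x) (g^[j] (e : X)) ≤ ε / 2) → b x = e := by
  classical
  let pat : X → (↥E → Prop) × (↥E → Prop) := fun x =>
    (fun e => ∀ j < n, dist (g^[j] x) (g^[j] (e : X)) ≤ ε / 2, fun e => ∀ j < n, dist (g^[j] x) (g^[j] (e : X)) ≤ ε)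
  have hmeas : ∀ (c : ℝ) (e : ↥E), MeasurableSet {x | ∀ j < n, dist (g^[j] x) (g^[j] (e : X)) ≤ c} := by
    intro c e
    have : {x | ∀ j < n, dist (g^[j] x) (g^[j] (e : X)) ≤ c} =
      ⋂ j ∈ Finset.range n, {x | dist (g^[j] x) (g^[j] (e : X)) ≤ c} := by ext; simp
    rw [this]
    refine IsClosed.measurableSet (isClosed_biInter (fun j _ => ?_))
    exact isClosed_le ((hg.iterate j).dist continuous_const) continuous_const
  have hpat1 : ∀ c, FM (fun x => (fun e : ↥E => ∀ j < n, dist (g^[j] x) (g^[j] (e : X)) ≤ c)) := by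
    intro c q
    have : (fun x => (fun e : ↥E => ∀ j < n, dist (g^[j] x) (g^[j] (e : X)) ≤ c)) ⁻¹' {q} =
        ⋂ e : ↥E, {x | (∀ j < n, dist (g^[j] x) (g^[j] (e : X)) ≤ c) ↔ q e} := by
      ext x; simp [funext_iff]
    rw [this]
    refine MeasurableSet.iInter (fun e => ?_)
    by_cases hq : q e
    · simpa [hq] using hmeas c e
    · simp only [hq, iff_false]; exact (hmeas c e).compl
  have hpat : FM pat := (hpat1 _).prod (hpat1 _)
  by_cases hX : IsEmpty X
  · exact ⟨fun x => (hX.false x).elim, fun i => by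
      rw [Set.eq_empty_of_isEmpty (_ ⁻¹' _)]; exact MeasurableSet.empty, fun x => (hX.false x).elim, fun x => (hX.false x).elim⟩
  rw [not_isEmpty_iff] at hX
  obtain ⟨x0⟩ := hX
  obtain ⟨e0, he0, -⟩ := hspan x0
  let F : (↥E → Prop) × (↥E → Prop) → ↥E := fun q =>
    if h : ∃ e, q.1 e then h.choose else if h : ∃ e, q.2 e then h.choose else ⟨e0, he0⟩
  have huniq : ∀ x (e e' : ↥E), (pat x).1 e → (pat x).1 e' → e = e' := by
    intro x e e' h1 h2
    by_contra hne
    obtain ⟨j, hj, hd⟩ := hE e.2 e'.2 (fun h => hne (Subtype.ext h))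
    have h3 := h1 j hj
    have h4 := h2 j hj
    have := dist_triangle_left (g^[j] (e : X)) (g^[j] (e' : X)) (g^[j] x)
    linarith
  refine ⟨F ∘ pat, hpat.comp F, ?_, ?_⟩
  · intro x j hj
    simp only [Function.comp_apply, F]
    split_ifs with h1 h2
    · have := h1.choose_spec j hj
      have h0 : 0 ≤ dist (g^[j] x) (g^[j] (h1.choose : X)) := dist_nonneg
      linarith
    · exact h2.choose_spec j hj
    · exfalso
      obtain ⟨e, he, h⟩ := hspan x
      exact h2 ⟨⟨e, he⟩, h⟩
  · intro x e he
    have hex : ∃ e, (pat x).1 e := ⟨e, he⟩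
    simp only [Function.comp_apply, F]
    rw [dif_pos hex]
    exact huniq x _ _ hex.choose_spec he

end Adapted
end SamvaAux

set_option linter.unusedVariables false
set_option linter.unusedSectionVars false
open MeasureTheory Filter Topology Set
open scoped ENNReal NNReal
open Samva

namespace SamvaAux

section Counting
variable {X : Type*} [MetricSpace X] [CompactSpace X]

/-- uniform expansivity -/
def UE (f : X → X) (α : ℝ) : Prop := ∀ δ : ℝ, 0 < δ → ∃ N : ℕ, ∀ x y : X,
  (∀ i ≤ 2 * N, dist (f^[i] x) (f^[i] y) ≤ α) → dist (f^[N] x) (f^[N] y) < δ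

lemma zIter_nat (f : X ≃ₜ X) (n : ℕ) (x : X) : zIter f (n : ℤ) x = f^[n] x := rfl

lemma symm_iter (f : X ≃ₜ X) (n : ℕ) (x : X) : f^[n] (f.symm^[n] x) = x :=
  (Function.LeftInverse.iterate (f := f.symm) (g := f) (fun x => f.apply_symm_apply x) n) x

lemma iter_symm (f : X ≃ₜ X) (n : ℕ) (x : X) : f.symm^[n] (f^[n] x) = x :=
  (Function.LeftInverse.iterate (f := f) (g := f.symm) (fun x => f.symm_apply_apply x) n) x

lemma zIter_cont (f : X ≃ₜ X) (n : ℤ) : Continuous (zIter f n) := by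
  cases n with
  | ofNat n => exact f.continuous.iterate n
  | negSucc n => exact f.symm.continuous.iterate (n+1)

lemma zIter_shift (f : X ≃ₜ X) (n : ℤ) (N : ℕ) (h : n.natAbs ≤ N) :
    ∃ i ≤ 2 * N, ∀ x, zIter f n (f^[N] x) = f^[i] x := by
  cases n with
  | ofNat n =>
    simp at h
    exact ⟨n + N, by omega, fun x => by rw [Function.iterate_add_apply]; rfl⟩
  | negSucc n =>
    simp at h
    refine ⟨N - (n+1), by omega, fun x => ?_⟩
    change f.symm^[n+1] (f^[N] x) = _
    obtain ⟨k, rfl⟩ : ∃ k, N = (n + 1) + k := ⟨N - (n+1), by omega⟩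
    rw [Function.iterate_add_apply f (n+1) k, iter_symm]
    congr 2; omega

lemma ue_of_expansive (f : X ≃ₜ X) (α : ℝ) (h : IsExpansiveWith f α) : UE f α := by
  intro δ hδ
  by_contra hcon
  push Not at hcon
  choose x y h1 h2 using hcon
  obtain ⟨⟨p, q⟩, -, φ, hφ, hlim⟩ := isCompact_univ.tendsto_subseq (x := fun N => (f^[N] (x N), f^[N] (y N)))
    (fun _ => mem_univ _)
  have hp : Tendsto (fun k => f^[φ k] (x (φ k))) atTop (𝓝 p) := (continuous_fst.tendsto _).comp hlim
  have hq : Tendsto (fun k => f^[φ k] (y (φ k))) atTop (𝓝 q) := (continuous_snd.tendsto _).comp hlim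
  have hd : δ ≤ dist p q := ge_of_tendsto' (hp.dist hq) (fun k => h2 (φ k))
  have hpq : p = q := by
    refine h.2 p q (fun n => ?_)
    refine le_of_tendsto ((((zIter_cont f n).tendsto p).comp hp).dist (((zIter_cont f n).tendsto q).comp hq)) ?_
    filter_upwards [eventually_ge_atTop n.natAbs] with k hk
    obtain ⟨i, hi, hz⟩ := zIter_shift f n (φ k) (hk.trans (hφ.id_le k))
    simp only [Function.comp_apply, hz]
    exact h1 _ i hi
  rw [hpq, dist_self] at hd
  linarith

/-- three block specification in natural times -/
def Spec3 (f : X → X) (ε : ℝ) (M : ℕ) : Prop := ∀ (n1 n2 n3 : ℕ) (x1 x2 x3 : X), ∃ z : X,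
  f^[n1 + n2 + n3 + 3 * M] z = z ∧
  (∀ j ≤ n1, dist (f^[j] z) (f^[j] x1) ≤ ε) ∧
  (∀ j ≤ n2, dist (f^[n1 + M + j] z) (f^[j] x2) ≤ ε) ∧
  (∀ j ≤ n3, dist (f^[n1 + n2 + 2 * M + j] z) (f^[j] x3) ≤ ε)

lemma spec3_of_spec (f : X ≃ₜ X) (h : HasSpecification f) (ε : ℝ) (hε : 0 < ε) : ∃ M, 1 ≤ M ∧ Spec3 f ε M := by
  obtain ⟨M0, hM0⟩ := h ε hε
  refine ⟨M0 + 1, by omega, ?_⟩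
  set M := M0 + 1 with hM
  intro n1 n2 n3 x1 x2 x3
  obtain ⟨z, hz1, hz2⟩ := hM0 2 ![x1, f.symm^[n1 + M] x2, f.symm^[n1 + n2 + 2 * M] x3]
    ![0, ((n1 + M : ℕ) : ℤ), ((n1 + n2 + 2 * M : ℕ) : ℤ)]
    ![(n1 : ℤ), ((n1 + M + n2 : ℕ) : ℤ), ((n1 + n2 + 2 * M + n3 : ℕ) : ℤ)]
    (by intro i; fin_cases i <;> simp)
    (by intro i; fin_cases i <;> simp <;> omega)
    ((n1 + n2 + n3 + 3 * M : ℕ) : ℤ) (by simp [Fin.last]; omega)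
  rw [zIter_nat] at hz1
  refine ⟨z, hz1, ?_, ?_, ?_⟩
  · intro j hj
    have := hz2 0 (j : ℤ) (by simp) (by simpa using hj)
    simpa [zIter_nat] using this
  · intro j hj
    have := hz2 1 ((n1 + M + j : ℕ) : ℤ) (by simp) (by simp; omega)
    rw [zIter_nat, zIter_nat] at this
    simp only [Matrix.cons_val_one, Matrix.cons_val_zero] at this
    rw [show f^[n1 + M + j] (f.symm^[n1 + M] x2) = f^[j] x2 by
      rw [add_comm, Function.iterate_add_apply, symm_iter]] at this
    exact this
  · intro j hj
    have := hz2 2 ((n1 + n2 + 2 * M + j : ℕ) : ℤ) (by simp) (by simp; omega)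
    rw [zIter_nat, zIter_nat] at this
    simp only [Matrix.cons_val] at this
    rw [show f^[n1 + n2 + 2 * M + j] (f.symm^[n1 + n2 + 2 * M] x3) = f^[j] x3 by
      rw [add_comm, Function.iterate_add_apply, symm_iter]] at this
    exact this

/-- maximal cardinality of a separated set -/
noncomputable def sn (f : X → X) (n : ℕ) (ε : ℝ) : ℕ := ⌊(sepCard f univ n ε).toReal⌋₊

lemma sn_max {f : X → X} (hf : Continuous f) (n : ℕ) {ε : ℝ} (hε : 0 < ε) :
    ∃ E : Finset X, IsSep f n ε ↑E ∧ sepCard f univ n ε = sn f n ε ∧ E.card = sn f n ε ∧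
      (∀ E' : Finset X, IsSep f n ε ↑E' → E'.card ≤ sn f n ε) ∧
      ∀ x, ∃ e ∈ E, ∀ j < n, dist (f^[j] x) (f^[j] e) ≤ ε := by
  obtain ⟨E, -, h1, h2, h3, h4⟩ := exists_max_sep hf univ n hε
  have : sn f n ε = E.card := by
    unfold sn; rw [h2]; simp
  rw [this]
  exact ⟨E, h1, h2, rfl, fun E' => h3 E' (subset_univ _), fun x => h4 x (mem_univ x)⟩

lemma card_le_sn {f : X → X} (hf : Continuous f) {n : ℕ} {ε : ℝ} (hε : 0 < ε) {E : Finset X}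
    (hE : IsSep f n ε ↑E) : E.card ≤ sn f n ε := by
  obtain ⟨_, _, _, _, h, _⟩ := sn_max hf n hε
  exact h E hE

lemma sn_anti {f : X → X} (hf : Continuous f) (n : ℕ) {ε ε' : ℝ} (hε : 0 < ε) (h : ε ≤ ε') :
    sn f n ε' ≤ sn f n ε := by
  obtain ⟨E, h1, _, h2, _⟩ := sn_max hf n (hε.trans_le h)
  rw [← h2]; exact card_le_sn hf hε (IsSep.mono h1 h)

lemma one_le_sn [Nonempty X] {f : X → X} (hf : Continuous f) (n : ℕ) {ε : ℝ} (hε : 0 < ε) : 1 ≤ sn f n ε := by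
  have := card_le_sn hf (n := n) hε (E := {Classical.arbitrary X}) (by simp [IsSep])
  simpa using this

lemma sn_zero [Nonempty X] {f : X → X} (hf : Continuous f) {ε : ℝ} (hε : 0 < ε) : sn f 0 ε = 1 := by
  refine le_antisymm ?_ (one_le_sn hf 0 hε)
  obtain ⟨E, h1, _, h2, _⟩ := sn_max hf 0 hε
  rw [← h2, Finset.card_le_one]
  intro a ha b hb
  by_contra hne
  obtain ⟨j, hj, _⟩ := h1 ha hb hne
  omega

lemma sn_submul {f : X → X} (hf : Continuous f) (n m : ℕ) {ε : ℝ} (hε : 0 < ε) :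
    sn f (n + m) (2 * ε) ≤ sn f n ε * sn f m ε := by
  classical
  obtain ⟨E, h1, _, h2, _⟩ := sn_max hf (n + m) (ε := 2 * ε) (by linarith)
  obtain ⟨A, -, -, hA, -, sA⟩ := sn_max hf n hε
  obtain ⟨B, -, -, hB, -, sB⟩ := sn_max hf m hε
  rw [← h2, ← hA, ← hB, ← Finset.card_product]
  choose p hp1 hp2 using sA
  choose q hq1 hq2 using sB
  refine Finset.card_le_card_of_injOn (fun x => (p x, q (f^[n] x))) (fun x _ => by simp [hp1, hq1]) ?_
  intro x hx y hy hxy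
  simp only [Prod.mk.injEq] at hxy
  by_contra hne
  obtain ⟨j, hj, hd⟩ := h1 hx hy hne
  by_cases hjn : j < n
  · have a1 := hp2 x j hjn
    have a2 := hp2 y j hjn
    rw [← hxy.1] at a2
    have := dist_triangle_right (f^[j] x) (f^[j] y) (f^[j] (p x))
    linarith
  · have a1 := hq2 (f^[n] x) (j - n) (by omega)
    have a2 := hq2 (f^[n] y) (j - n) (by omega)
    rw [← hxy.2] at a2
    rw [← Function.iterate_add_apply, show j - n + n = j by omega] at a1 a2
    have := dist_triangle_right (f^[j] x) (f^[j] y) (f^[j - n] (q (f^[n] x)))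
    linarith

lemma sn_ue (f : X ≃ₜ X) {α ε : ℝ} (hα : 0 < α) (hε : 0 < ε) {N : ℕ} (hN : ∀ x y : X,
    (∀ i ≤ 2 * N, dist (f^[i] x) (f^[i] y) ≤ α) → dist (f^[N] x) (f^[N] y) < ε) (n : ℕ) :
    sn f n ε ≤ sn f (n + 2 * N) α := by
  classical
  obtain ⟨E, h1, _, h2, _⟩ := sn_max f.continuous n hε
  have hinj : Function.Injective (f.symm^[N]) := f.symm.injective.iterate N
  have hcard : (E.image (f.symm^[N])).card = E.card := Finset.card_image_of_injective _ hinj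
  rw [← h2, ← hcard]
  refine card_le_sn f.continuous hα ?_
  intro x' hx y' hy hxy
  rw [Finset.coe_image] at hx hy
  obtain ⟨x, hx, rfl⟩ := hx
  obtain ⟨y, hy, rfl⟩ := hy
  obtain ⟨j, hj, hd⟩ := h1 hx hy (fun h => hxy (by rw [h]))
  by_contra hcon
  push Not at hcon
  have := hN (f^[j] (f.symm^[N] x)) (f^[j] (f.symm^[N] y)) (fun i hi => by
    rw [← Function.iterate_add_apply, ← Function.iterate_add_apply]
    exact hcon (i + j) (by omega))
  rw [← Function.iterate_add_apply, ← Function.iterate_add_apply, add_comm, Function.iterate_add_apply,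
    Function.iterate_add_apply, symm_iter, symm_iter] at this
  linarith

lemma eq_of_periodic {f : X → X} {α : ℝ} (h : UE f α) {N : ℕ} (hN : 1 ≤ N) {x y : X} (hx : f^[N] x = x) (hy : f^[N] y = y)
    (hd : ∀ j < N, dist (f^[j] x) (f^[j] y) ≤ α) : x = y := by
  have hmul : ∀ {w : X} (hw : f^[N] w = w) (k : ℕ), f^[N * k] w = w := by
    intro w hw k
    rw [Function.iterate_mul]
    exact Function.iterate_fixed hw k
  have hall : ∀ j, dist (f^[j] x) (f^[j] y) ≤ α := by
    intro j
    have e : j = j % N + N * (j / N) := (Nat.mod_add_div j N).symm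
    rw [e, Function.iterate_add_apply, Function.iterate_add_apply, hmul hx, hmul hy]
    exact hd _ (Nat.mod_lt _ hN)
  by_contra hne
  obtain ⟨K, hK⟩ := h (dist x y) (dist_pos.2 hne)
  have hle : K ≤ N * K := by nlinarith
  have := hK (f^[N * K - K] x) (f^[N * K - K] y) (fun i _ => by
    rw [← Function.iterate_add_apply, ← Function.iterate_add_apply]; exact hall _)
  rw [← Function.iterate_add_apply, ← Function.iterate_add_apply, show K + (N * K - K) = N * K by omega, hmul hx, hmul hy] at this
  exact lt_irrefl _ this

lemma per_sep {f : X → X} {α : ℝ} (h : UE f α) {N : ℕ} (hN : 1 ≤ N) : IsSep f N α (perSet f N) := by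
  intro x hx y hy hxy
  by_contra hcon
  push Not at hcon
  exact hxy (eq_of_periodic h hN hx hy hcon)

lemma finite_of_sep {f : X → X} (hf : Continuous f) {α : ℝ} (hα : 0 < α) {N : ℕ} {S : Set X} (hS : IsSep f N α S) : S.Finite := by
  by_contra hinf
  obtain ⟨t, ht1, ht2⟩ := Set.Infinite.exists_subset_card_eq hinf (sn f N α + 1)
  have := card_le_sn hf hα (E := t) (fun x hx y hy hxy => hS (ht1 hx) (ht1 hy) hxy)
  omega

lemma ncard_le_sn {f : X → X} (hf : Continuous f) {α : ℝ} (hα : 0 < α) {N : ℕ} {S : Set X} (hS : IsSep f N α S) : S.ncard ≤ sn f N α := by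
  classical
  have hfin := finite_of_sep hf hα hS
  rw [Set.ncard_eq_toFinset_card S hfin]
  exact card_le_sn hf hα (by simpa using hS)

lemma spec_count {f : X → X} (hf : Continuous f) {α : ℝ} (hα : 0 < α) (h : UE f α) {M : ℕ} (hM : 1 ≤ M)
    (hs : Spec3 f (α / 4) M) (n m : ℕ) :
    sn f n (α / 2) * sn f m (α / 2) ≤ (perSet f (n + m + 3 * M)).ncard := by
  classical
  obtain ⟨A, sA, -, hA, -, -⟩ := sn_max hf n (ε := α / 2) (by linarith)
  obtain ⟨B, sB, -, hB, -, -⟩ := sn_max hf m (ε := α / 2) (by linarith)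
  rw [← hA, ← hB, ← Finset.card_product]
  have hfin := finite_of_sep hf hα (per_sep h (N := n + m + 3 * M) (by omega))
  rw [Set.ncard_eq_toFinset_card _ hfin]
  choose z hz1 hz2 hz3 _ using fun p : X × X => hs n m 0 p.1 p.2 p.1
  refine Finset.card_le_card_of_injOn z (fun p _ => by simpa [perSet] using hz1 p) ?_
  rintro p hp q hq hpq
  simp only [Finset.coe_product, mem_prod] at hp hq
  refine Prod.ext ?_ ?_
  · by_contra hne
    obtain ⟨j, hj, hd⟩ := sA hp.1 hq.1 hne
    have a1 := hz2 p j hj.le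
    have a2 := hz2 q j hj.le
    rw [← hpq] at a2
    have := dist_triangle_left (f^[j] p.1) (f^[j] q.1) (f^[j] (z p))
    linarith
  · by_contra hne
    obtain ⟨j, hj, hd⟩ := sB hp.2 hq.2 hne
    have a1 := hz3 p j hj.le
    have a2 := hz3 q j hj.le
    rw [← hpq] at a2
    have := dist_triangle_left (f^[j] p.2) (f^[j] q.2) (f^[n + M + j] (z p))
    linarith

end Counting

/-- growth lemma -/
lemma growth (u : ℕ → ℝ) (K : ℝ) (hK : 1 ≤ K) (hu : ∀ n, 1 ≤ u n) (h1 : ∀ n m, u (n + m) ≤ K * (u n * u m))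
    (h2 : ∀ n m, u n * u m ≤ K * u (n + m)) :
    ∃ H : ℝ, ∀ n : ℕ, u n ≤ K * Real.exp (n * H) ∧ Real.exp (n * H) ≤ K * u n := by
  have hK0 : 0 < K := by linarith
  have hpos : ∀ n, 0 < u n := fun n => by linarith [hu n]
  have s1 : Subadditive (fun n => Real.log (u n) + Real.log K) := by
    intro n m
    have := Real.log_le_log (hpos _) (h1 n m)
    rw [Real.log_mul hK0.ne' (mul_pos (hpos _) (hpos _)).ne', Real.log_mul (hpos _).ne' (hpos _).ne'] at this
    simp only; linarith
  have b1 : BddBelow (Set.range fun n : ℕ => (Real.log (u n) + Real.log K) / n) := by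
    refine ⟨0, ?_⟩
    rintro _ ⟨n, rfl⟩
    have := Real.log_nonneg (hu n)
    have := Real.log_nonneg hK
    positivity
  have t1 := s1.tendsto_lim b1
  set H := s1.lim
  have lo : ∀ n : ℕ, n * H ≤ Real.log (u n) + Real.log K := by
    intro n
    rcases Nat.eq_zero_or_pos n with rfl | hn
    · have := Real.log_nonneg (hu 0)
      have := Real.log_nonneg hK
      simp; positivity
    · have := s1.lim_le_div b1 hn.ne'
      rw [le_div_iff₀ (by exact_mod_cast hn)] at this
      linarith
  have pw : ∀ n k : ℕ, (k + 1 : ℝ) * (Real.log (u n) - Real.log K) ≤ Real.log (u ((k + 1) * n)) := by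
    intro n k
    induction k with
    | zero => simp; exact Real.log_nonneg hK
    | succ k ih =>
      have := Real.log_le_log (mul_pos (hpos _) (hpos _)) (h2 ((k+1) * n) n)
      rw [Real.log_mul hK0.ne' (hpos _).ne', Real.log_mul (hpos _).ne' (hpos _).ne'] at this
      rw [show (k + 1 + 1) * n = (k+1) * n + n by ring]
      push_cast
      linarith
  have hi : ∀ n : ℕ, Real.log (u n) - Real.log K ≤ n * H := by
    intro n
    rcases Nat.eq_zero_or_pos n with rfl | hn
    · have := h2 0 0
      simp at this ⊢
      have : u 0 ≤ K := le_of_mul_le_mul_right this (hpos 0)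
      exact Real.log_le_log (hpos 0) this
    · have hn' : (0:ℝ) < n := by exact_mod_cast hn
      have t2 := t1.comp ((tendsto_add_atTop_nat 1).atTop_mul_const' hn : Tendsto (fun k : ℕ => (k + 1) * n) atTop atTop)
      have : (Real.log (u n) - Real.log K) / n ≤ H := by
        refine ge_of_tendsto' t2 (fun k => ?_)
        simp only [Function.comp_apply]
        have := pw n k
        have hk : (0:ℝ) < k + 1 := by positivity
        push_cast
        rw [div_le_div_iff₀ hn' (by positivity)]
        have hlK := Real.log_nonneg hK
        nlinarith
      rw [div_le_iff₀ hn'] at this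
      linarith
  refine ⟨H, fun n => ⟨?_, ?_⟩⟩
  · rw [← Real.log_le_log_iff (hpos n) (by positivity), Real.log_mul hK0.ne' (Real.exp_pos _).ne', Real.log_exp]
    linarith [hi n]
  · rw [← Real.log_le_log_iff (Real.exp_pos _) (mul_pos hK0 (hpos n)), Real.log_mul hK0.ne' (hpos _).ne', Real.log_exp]
    linarith [lo n]

/-- all the counting data for the base system -/
structure BD {X : Type*} [MetricSpace X] [CompactSpace X] (f : X ≃ₜ X) where
  α : ℝ
  hα : 0 < α
  ue : UE f α
  M : ℕ
  hM : 1 ≤ M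
  spec : Spec3 f (α / 4) M
  H : ℝ
  K : ℝ
  hK : 1 ≤ K
  up : ∀ n : ℕ, (sn f n (α / 2) : ℝ) ≤ K * Real.exp (n * H)
  lo : ∀ n : ℕ, Real.exp (n * H) ≤ K * (sn f n (α / 2) : ℝ)
  perup : ∀ n : ℕ, 1 ≤ n → ((perSet f n).ncard : ℝ) ≤ K * Real.exp (n * H)
  perlo : ∀ n : ℕ, 3 * M ≤ n → Real.exp (n * H) ≤ K * ((perSet f n).ncard : ℝ)

lemma exists_BD {X : Type*} [MetricSpace X] [CompactSpace X] [Nonempty X] (f : X ≃ₜ X) (h1 : IsExpansive f)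
    (h2 : HasSpecification f) : Nonempty (BD f) := by
  obtain ⟨α, h⟩ := h1
  have hα := h.1
  have ue := ue_of_expansive f α h
  obtain ⟨M, hM, spec⟩ := spec3_of_spec f h2 (α / 4) (by linarith)
  have hα2 : 0 < α / 2 := by linarith
  obtain ⟨N, hN⟩ := ue (α / 2) hα2
  have hf := f.continuous
  set u : ℕ → ℕ := fun n => sn f n (α / 2) with hu
  set v : ℕ → ℕ := fun n => sn f n α with hv
  have vu : ∀ n, v n ≤ u n := fun n => sn_anti hf n hα2 (by linarith)
  have uv : ∀ n, u n ≤ v (n + 2 * N) := fun n => sn_ue f hα hα2 hN n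
  have sub : ∀ n m, v (n + m) ≤ u n * u m := fun n m => by
    have := sn_submul hf n m hα2
    rwa [show 2 * (α / 2) = α by ring] at this
  have sup : ∀ n m, u n * u m ≤ (perSet f (n + m + 3 * M)).ncard := fun n m => spec_count hf hα ue hM spec n m
  have pv : ∀ n, 1 ≤ n → (perSet f n).ncard ≤ v n := fun n hn => ncard_le_sn hf hα (per_sep ue hn)
  have u1 : ∀ n, 1 ≤ u n := fun n => one_le_sn hf n hα2
  have usub : ∀ n m, u (n + m) ≤ u (4 * N) * (u n * u m) := by
    intro n m
    calc u (n + m) ≤ v (n + m + 2 * N) := uv _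
      _ = v (n + (m + 2 * N)) := by rw [add_assoc]
      _ ≤ u n * u (m + 2 * N) := sub _ _
      _ ≤ u n * v (m + 2 * N + 2 * N) := Nat.mul_le_mul_left _ (uv _)
      _ = u n * v (m + 4 * N) := by congr 2; ring
      _ ≤ u n * (u m * u (4 * N)) := Nat.mul_le_mul_left _ (sub _ _)
      _ = _ := by ring
  set K0 := u (4 * N) * u (3 * M) with hK0
  have hK01 : 1 ≤ K0 := Nat.one_le_iff_ne_zero.2 (Nat.mul_ne_zero (by have := u1 (4*N); omega) (by have := u1 (3*M); omega))
  have usup : ∀ n m, u n * u m ≤ K0 * u (n + m) := by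
    intro n m
    calc u n * u m ≤ (perSet f (n + m + 3 * M)).ncard := sup n m
      _ ≤ v _ := pv _ (by omega)
      _ ≤ u _ := vu _
      _ ≤ u (4 * N) * (u (n + m) * u (3 * M)) := usub _ _
      _ = _ := by rw [hK0]; ring
  have usub' : ∀ n m, u (n + m) ≤ K0 * (u n * u m) := fun n m => (usub n m).trans (Nat.mul_le_mul_right _ (by
    rw [hK0]; exact Nat.le_mul_of_pos_right _ (u1 _)))
  obtain ⟨H, hH⟩ := growth (fun n => (u n : ℝ)) K0 (by exact_mod_cast hK01) (fun n => by exact_mod_cast u1 n)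
    (fun n m => by exact_mod_cast usub' n m) (fun n m => by exact_mod_cast usup n m)
  have hK1 : (1:ℝ) ≤ K0 := by exact_mod_cast hK01
  have hKK : (K0 : ℝ) ≤ K0 * K0 := by nlinarith
  refine ⟨⟨α, hα, ue, M, hM, spec, H, K0 * K0, by nlinarith, ?_, ?_, ?_, ?_⟩⟩
  · intro n
    refine (hH n).1.trans ?_
    gcongr
  · intro n
    refine (hH n).2.trans ?_
    gcongr
  · intro n hn
    have : ((perSet f n).ncard : ℝ) ≤ u n := by exact_mod_cast (pv n hn).trans (vu n)
    refine this.trans ((hH n).1.trans ?_)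
    gcongr
  · intro n hn
    refine (hH n).2.trans ?_
    have a1 : u n ≤ K0 * (perSet f n).ncard := by
      obtain ⟨k, rfl⟩ : ∃ k, n = k + 3 * M := ⟨n - 3 * M, by omega⟩
      have h3 := sup k 0
      have h4 := usub k (3 * M)
      rw [show u 0 = 1 from sn_zero hf hα2] at h3
      simp at h3
      calc u (k + 3 * M) ≤ u (4 * N) * (u k * u (3 * M)) := h4
        _ = K0 * u k := by rw [hK0]; ring
        _ ≤ _ := Nat.mul_le_mul_left _ h3
    have a2 : (u n : ℝ) ≤ K0 * ((perSet f n).ncard : ℝ) := by exact_mod_cast a1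
    nlinarith

end SamvaAux

set_option linter.unusedVariables false
set_option linter.unusedSectionVars false
open MeasureTheory Filter Topology Set
open scoped ENNReal NNReal
open Samva

namespace SamvaAux

lemma log_div_coe (s n : ℕ) (hs : 1 ≤ s) : ENNReal.log (s : ℝ≥0∞) / (n : EReal) = ((Real.log s / n : ℝ) : EReal) := by
  have : ENNReal.log (s : ℝ≥0∞) = ((Real.log s : ℝ) : EReal) := by
    have := ENNReal.log_ofReal_of_pos (x := (s:ℝ)) (by exact_mod_cast hs)
    rw [← this]; simp
  rw [this, EReal.coe_div]; rfl

section
variable {X : Type*} [MetricSpace X] [CompactSpace X]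

lemma topEntropy_le [Nonempty X] {g : X → X} (hg : Continuous g) (c : ℝ)
    (h : ∀ ε > 0, ∀ τ > 0, ∃ C : ℝ, ∀ n : ℕ, (sn g n ε : ℝ) ≤ C * Real.exp (n * (c + τ))) : topEntropy g ≤ c := by
  unfold topEntropy relEntropy
  refine iSup₂_le (fun ε hε => ?_)
  refine EReal.le_of_forall_lt_iff_le.1 ?_
  intro z hz
  have hz' : c < z := by exact_mod_cast hz
  obtain ⟨C, hC⟩ := h ε hε ((z - c) / 2) (by linarith)
  have hC0 : 0 < C := by
    have h1 := hC 0
    have h2 : (1:ℝ) ≤ sn g 0 ε := by exact_mod_cast one_le_sn hg 0 hε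
    simp at h1; linarith
  refine limsup_le_of_le (by isBoundedDefault) ?_
  have ht : Tendsto (fun n : ℕ => Real.log C / n) atTop (𝓝 0) := tendsto_const_div_atTop_nhds_zero_nat _
  filter_upwards [ht.eventually (gt_mem_nhds (show 0 < (z - c)/2 by linarith)), eventually_ge_atTop 1] with n hn hn1
  obtain ⟨_, _, h2, _⟩ := sn_max hg n hε
  rw [h2, log_div_coe _ _ (one_le_sn hg n hε), EReal.coe_le_coe_iff]
  have hn0 : (0:ℝ) < n := by exact_mod_cast hn1
  have hs : (0:ℝ) < sn g n ε := by exact_mod_cast one_le_sn hg n hε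
  have h3 := Real.log_le_log hs (hC n)
  rw [Real.log_mul hC0.ne' (Real.exp_pos _).ne', Real.log_exp] at h3
  rw [div_lt_iff₀ hn0] at hn
  rw [div_le_iff₀ hn0]
  nlinarith

lemma le_topEntropy [Nonempty X] {g : X → X} (hg : Continuous g) (c : ℝ) (ε : ℝ) (hε : 0 < ε) (C : ℝ)
    (h : ∀ n : ℕ, Real.exp (n * c) ≤ C * (sn g n ε : ℝ)) : (c : EReal) ≤ topEntropy g := by
  unfold topEntropy relEntropy
  refine le_iSup₂_of_le ε hε ?_
  refine EReal.ge_of_forall_gt_iff_ge.1 ?_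
  intro z hz
  have hz' : z < c := by exact_mod_cast hz
  have hC0 : 0 < C := by
    have h1 := h 0
    have h2 : (1:ℝ) ≤ sn g 0 ε := by exact_mod_cast one_le_sn hg 0 hε
    simp at h1
    by_contra hneg
    push Not at hneg
    nlinarith
  refine le_limsup_of_frequently_le (Eventually.frequently ?_) (by isBoundedDefault)
  have ht : Tendsto (fun n : ℕ => Real.log C / n) atTop (𝓝 0) := tendsto_const_div_atTop_nhds_zero_nat _
  filter_upwards [ht.eventually (gt_mem_nhds (show 0 < c - z by linarith)), eventually_ge_atTop 1] with n hn hn1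
  obtain ⟨_, _, h2, _⟩ := sn_max hg n hε
  rw [h2, log_div_coe _ _ (one_le_sn hg n hε), EReal.coe_le_coe_iff]
  have hn0 : (0:ℝ) < n := by exact_mod_cast hn1
  have hs : (0:ℝ) < sn g n ε := by exact_mod_cast one_le_sn hg n hε
  have h3 := Real.log_le_log (Real.exp_pos _) (h n)
  rw [Real.log_mul hC0.ne' hs.ne', Real.log_exp] at h3
  rw [div_lt_iff₀ hn0] at hn
  rw [le_div_iff₀ hn0]
  nlinarith

lemma fiber_span {g : X → X} (hg : Continuous g) {K : Set X} (hK : K.Nonempty) (h : relEntropy g K = 0)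
    {ε τ : ℝ} (hε : 0 < ε) (hτ : 0 < τ) : ∃ k : ℕ, 1 ≤ k ∧ ∃ E : Finset X, (E.card : ℝ) ≤ Real.exp (τ * k) ∧
      ∀ x ∈ K, ∃ e ∈ E, ∀ j < k, dist (g^[j] x) (g^[j] e) ≤ ε := by
  have h1 : limsup (fun n : ℕ => ENNReal.log (sepCard g K n ε) / (n : EReal)) atTop < (τ : EReal) := by
    have : limsup (fun n : ℕ => ENNReal.log (sepCard g K n ε) / (n : EReal)) atTop ≤ relEntropy g K :=
      le_iSup₂ (f := fun (ε : ℝ) (_ : 0 < ε) => limsup (fun n : ℕ => ENNReal.log (sepCard g K n ε) / (n : EReal)) atTop) ε hε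
    rw [h] at this
    exact this.trans_lt (by exact_mod_cast hτ)
  obtain ⟨k, hk, hk1⟩ := ((eventually_lt_of_limsup_lt h1).and (eventually_ge_atTop 1)).exists
  obtain ⟨E, hEK, hEs, hEc, -, hsp⟩ := exists_max_sep hg K k hε
  refine ⟨k, hk1, E, ?_, hsp⟩
  have hEne : 1 ≤ E.card := by
    obtain ⟨x, hx⟩ := hK
    obtain ⟨e, he, _⟩ := hsp x hx
    exact Finset.card_pos.2 ⟨e, he⟩
  rw [hEc, log_div_coe _ _ hEne, EReal.coe_lt_coe_iff, div_lt_iff₀ (by exact_mod_cast hk1)] at hk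
  exact ((Real.log_lt_iff_lt_exp (by exact_mod_cast hEne)).1 hk).le

lemma block {g h : X → X} (hg : Continuous g) (hh : Continuous h) (hs : Function.Surjective h)
    (H1 : ∀ x, relEntropy g (h ⁻¹' {h x}) = 0) {ε τ : ℝ} (hε : 0 < ε) (hτ : 0 < τ) :
    ∃ δ > 0, ∃ K : ℕ, ∀ y : X, ∃ k : ℕ, 1 ≤ k ∧ k ≤ K ∧ ∃ E : Finset X, (E.card : ℝ) ≤ Real.exp (τ * k) ∧
      ∀ x, dist y (h x) ≤ δ → ∃ e ∈ E, ∀ j < k, dist (g^[j] x) (g^[j] e) ≤ ε := by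
  classical
  have loc : ∀ y : X, ∃ δ > 0, ∃ k : ℕ, 1 ≤ k ∧ ∃ E : Finset X, (E.card : ℝ) ≤ Real.exp (τ * k) ∧
      ∀ x, dist y (h x) < 2 * δ → ∃ e ∈ E, ∀ j < k, dist (g^[j] x) (g^[j] e) ≤ ε := by
    intro y
    obtain ⟨x0, rfl⟩ := hs y
    obtain ⟨k, hk, E, hE, hsp⟩ := fiber_span hg (K := h ⁻¹' {h x0}) ⟨x0, rfl⟩ (H1 x0) (ε := ε / 2) (by linarith) hτ
    let U : Set X := ⋃ e ∈ E, ⋂ j ∈ Finset.range k, {x | dist (g^[j] x) (g^[j] e) < ε}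
    have hU : IsOpen U := isOpen_biUnion (fun e _ => isOpen_biInter_finset (fun j _ =>
      isOpen_lt ((hg.iterate j).dist continuous_const) continuous_const))
    have hsub : h ⁻¹' {h x0} ⊆ U := by
      intro x hx
      obtain ⟨e, he, hd⟩ := hsp x hx
      simp only [U, mem_iUnion, mem_iInter, Finset.mem_range]
      exact ⟨e, he, fun j hj => by have := hd j hj; show dist _ _ < ε; linarith⟩
    have hcl : IsCompact (h '' Uᶜ) := (hU.isClosed_compl.isCompact).image hh
    have hno : h x0 ∈ (h '' Uᶜ)ᶜ := by
      rintro ⟨x, hx, hxe⟩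
      exact hx (hsub hxe)
    obtain ⟨r, hr, hball⟩ := Metric.isOpen_iff.1 hcl.isClosed.isOpen_compl _ hno
    refine ⟨r / 2, by linarith, k, hk, E, hE, fun x hx => ?_⟩
    have hxU : x ∈ U := by
      by_contra hxU
      have : h x ∈ Metric.ball (h x0) r := by rw [Metric.mem_ball, dist_comm]; linarith
      exact hball this ⟨x, hxU, rfl⟩
    simp only [U, mem_iUnion, mem_iInter, Finset.mem_range] at hxU
    obtain ⟨e, he, hd⟩ := hxU
    exact ⟨e, he, fun j hj => le_of_lt (hd j hj)⟩
  choose δ hδ k hk E hE hsp using loc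
  obtain ⟨t, ht⟩ := isCompact_univ.elim_finite_subcover (fun y => Metric.ball y (δ y)) (fun y => Metric.isOpen_ball)
    (fun y _ => mem_iUnion.2 ⟨y, Metric.mem_ball_self (hδ y)⟩)
  obtain ⟨d, hd0, hd⟩ : ∃ d > 0, ∀ y ∈ t, d ≤ δ y := by
    clear ht
    induction t using Finset.induction_on with
    | empty => exact ⟨1, one_pos, by simp⟩
    | insert a s _ ih =>
      obtain ⟨d, hd0, hd⟩ := ih
      refine ⟨min d (δ a), lt_min hd0 (hδ a), ?_⟩
      intro y hy
      rcases Finset.mem_insert.1 hy with rfl | hy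
      · exact min_le_right _ _
      · exact (min_le_left _ _).trans (hd y hy)
  refine ⟨d, hd0, t.sup k, fun y => ?_⟩
  obtain ⟨y', hy', hyy⟩ : ∃ y' ∈ t, y ∈ Metric.ball y' (δ y') := by simpa using ht (mem_univ y)
  refine ⟨k y', hk y', Finset.le_sup hy', E y', hE y', fun x hx => hsp y' x ?_⟩
  rw [Metric.mem_ball, dist_comm] at hyy
  have := dist_triangle y' y (h x)
  have := hd y' hy'
  linarith

lemma fiber_code {f g h : X → X} (hg : Continuous g) (hh : Continuous h) (hs : Function.Surjective h)
    (hsemi : ∀ x, f (h x) = h (g x))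
    (H1 : ∀ x, relEntropy g (h ⁻¹' {h x}) = 0) {ε τ : ℝ} (hε : 0 < ε) (hτ : 0 < τ) :
    ∃ δ > 0, ∃ L : ℝ, ∀ (n : ℕ) (y : X), ∃ N : ℕ, (N : ℝ) ≤ Real.exp (τ * n + L) ∧ ∃ c : X → Fin N,
      ∀ x x', (∀ j < n, dist (f^[j] y) (f^[j] (h x)) ≤ δ) → (∀ j < n, dist (f^[j] y) (f^[j] (h x')) ≤ δ) →
        c x = c x' → ∀ j < n, dist (g^[j] x) (g^[j] x') ≤ ε := by
  classical
  obtain ⟨δ, hδ, K, hb⟩ := block hg hh hs H1 (ε := ε / 2) (by linarith) hτ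
  have hiter : ∀ k x, f^[k] (h x) = h (g^[k] x) := by
    intro k x
    exact ((show Function.Semiconj h g f from fun x => (hsemi x).symm).iterate_right k x).symm
  refine ⟨δ, hδ, τ * K, fun n => ?_⟩
  induction n using Nat.strong_induction_on with
  | _ n ih =>
  intro y
  rcases Nat.eq_zero_or_pos n with rfl | hn
  · exact ⟨1, by simp; positivity, fun _ => 0, by simp⟩
  obtain ⟨k, hk1, hkK, E, hE, hsp⟩ := hb y
  have hEne : ∃ e, e ∈ E := by
    obtain ⟨x, hx⟩ := hs y
    obtain ⟨e, he, _⟩ := hsp x (by rw [hx, dist_self]; exact hδ.le)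
    exact ⟨e, he⟩
  obtain ⟨e0, he0⟩ := hEne
  have hex : ∀ x, ∃ e : ↥E, dist y (h x) ≤ δ → ∀ j < k, dist (g^[j] x) (g^[j] (e : X)) ≤ ε / 2 := by
    intro x
    by_cases hx : dist y (h x) ≤ δ
    · obtain ⟨e, he, hd⟩ := hsp x hx
      exact ⟨⟨e, he⟩, fun _ => hd⟩
    · exact ⟨⟨e0, he0⟩, fun h => absurd h hx⟩
  choose c1 hc1 using hex
  have hclose : ∀ x x', dist y (h x) ≤ δ → dist y (h x') ≤ δ → c1 x = c1 x' → ∀ j < k, dist (g^[j] x) (g^[j] x') ≤ ε := by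
    intro x x' h1 h2 he j hj
    have a1 := hc1 x h1 j hj
    have a2 := hc1 x' h2 j hj
    rw [← he] at a2
    have := dist_triangle_right (g^[j] x) (g^[j] x') (g^[j] (c1 x : X))
    linarith
  have hkK' : (k : ℝ) ≤ K := by exact_mod_cast hkK
  by_cases hnk : n ≤ k
  · refine ⟨E.card, hE.trans ?_, fun x => E.equivFin (c1 x), ?_⟩
    · apply Real.exp_le_exp.2
      have : 0 ≤ τ * n := by positivity
      nlinarith
    · intro x x' h1 h2 he j hj
      exact hclose x x' (h1 0 hn) (h2 0 hn) (E.equivFin.injective he) j (by omega)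
  · obtain ⟨N', hN', c2, hc2⟩ := ih (n - k) (by omega) (f^[k] y)
    refine ⟨E.card * N', ?_, fun x => finProdFinEquiv (E.equivFin (c1 x), c2 (g^[k] x)), ?_⟩
    · push_cast
      calc (E.card : ℝ) * N' ≤ Real.exp (τ * k) * Real.exp (τ * (n - k : ℕ) + τ * K) := by gcongr
        _ = _ := by
          rw [← Real.exp_add, Nat.cast_sub (by omega)]; congr 1; ring
    · intro x x' h1 h2 he j hj
      have he' := finProdFinEquiv.injective he
      simp only [Prod.mk.injEq] at he'
      by_cases hjk : j < k
      · exact hclose x x' (h1 0 hn) (h2 0 hn) (E.equivFin.injective he'.1) j hjk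
      · have hsh : ∀ w, (∀ j < n, dist (f^[j] y) (f^[j] (h w)) ≤ δ) →
            ∀ j < n - k, dist (f^[j] (f^[k] y)) (f^[j] (h (g^[k] w))) ≤ δ := by
          intro w hw i hi
          rw [← hiter, ← Function.iterate_add_apply, ← Function.iterate_add_apply]
          exact hw _ (by omega)
        have := hc2 (g^[k] x) (g^[k] x') (hsh x h1) (hsh x' h2) he'.2 (j - k) (by omega)
        rwa [← Function.iterate_add_apply, ← Function.iterate_add_apply, show j - k + k = j by omega] at this

lemma topEntropy_g [Nonempty X] {f g : X ≃ₜ X} {h : X → X} (D : BD f) (hh : Continuous h) (hs : Function.Surjective h)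
    (hsemi : ∀ x, f (h x) = h (g x))
    (H1 : ∀ x, relEntropy g (h ⁻¹' {h x}) = 0) : topEntropy g = D.H := by
  classical
  have hiter : ∀ k x, f^[k] (h x) = h (g^[k] x) := by
    intro k x
    exact ((show Function.Semiconj h g f from fun x => (hsemi x).symm).iterate_right k x).symm
  apply le_antisymm
  · refine topEntropy_le g.continuous D.H ?_
    intro ε hε τ hτ
    obtain ⟨δ, hδ, L, hc⟩ := fiber_code (f := f) g.continuous hh hs hsemi H1 hε hτ
    obtain ⟨N, hN⟩ := D.ue δ hδ
    have hα2 : 0 < D.α / 2 := by have := D.hα; linarith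
    refine ⟨D.K * Real.exp (2 * N * D.H) * Real.exp L, fun n => ?_⟩
    obtain ⟨A, -, -, hA, -, sA⟩ := sn_max f.continuous n hδ
    obtain ⟨E, sE, -, hE, -, -⟩ := sn_max g.continuous n hε
    have hAc : (A.card : ℝ) ≤ D.K * Real.exp (2 * N * D.H) * Real.exp (n * D.H) := by
      have h1 : sn f n δ ≤ sn f (n + 2 * N) (D.α / 2) :=
        (sn_ue f D.hα hδ hN n).trans (sn_anti f.continuous _ hα2 (by linarith))
      rw [hA]
      calc (sn f n δ : ℝ) ≤ sn f (n + 2 * N) (D.α / 2) := by exact_mod_cast h1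
        _ ≤ _ := D.up _
        _ = _ := by rw [mul_assoc, ← Real.exp_add]; push_cast; ring_nf
    choose p hp1 hp2 using sA
    choose cN hcN cc hcc using hc n
    set N1 := ⌊Real.exp (τ * n + L)⌋₊ with hN1
    have hle : ∀ y, cN y ≤ N1 := fun y => Nat.le_floor (hcN y)
    have hcard : E.card ≤ (A ×ˢ (Finset.univ : Finset (Fin N1))).card := by
      refine Finset.card_le_card_of_injOn (fun x => (p (h x), Fin.castLE (hle _) (cc (p (h x)) x))) (fun x _ => by simp [hp1]) ?_
      intro x hx x' hx' he
      simp only [Prod.mk.injEq] at he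
      by_contra hne
      obtain ⟨j, hj, hd⟩ := sE hx hx' hne
      have he2 : cc (p (h x)) x = cc (p (h x)) x' := by
        have h2 := congrArg Fin.val he.2
        rw [Fin.val_castLE, Fin.val_castLE] at h2
        apply Fin.ext
        rw [h2, ← he.1]
      have := hcc (p (h x)) x x' (fun j hj => by rw [dist_comm]; exact hp2 _ j hj)
        (fun j hj => by rw [he.1, dist_comm]; exact hp2 _ j hj) he2 j hj
      linarith
    rw [Finset.card_product, Finset.card_univ, Fintype.card_fin, hE] at hcard
    calc (sn g n ε : ℝ) ≤ A.card * N1 := by exact_mod_cast hcard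
      _ ≤ (D.K * Real.exp (2 * N * D.H) * Real.exp (n * D.H)) * Real.exp (τ * n + L) := by
        have hK0 : 0 < D.K := by have := D.hK; linarith
        exact mul_le_mul hAc (Nat.floor_le (Real.exp_pos _).le) (by positivity) (by positivity)
      _ = _ := by rw [show (n : ℝ) * (D.H + τ) = n * D.H + τ * n by ring, Real.exp_add, Real.exp_add]; ring
  · have hα2 : 0 < D.α / 2 := by have := D.hα; linarith
    have huc := (CompactSpace.uniformContinuous_of_continuous hh)
    obtain ⟨δ, hδ, hd⟩ := Metric.uniformContinuous_iff.1 huc (D.α / 2) hα2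
    refine le_topEntropy g.continuous D.H (δ / 2) (by linarith) D.K (fun n => ?_)
    refine (D.lo n).trans ?_
    have hK0 : 0 ≤ D.K := by have := D.hK; linarith
    refine mul_le_mul_of_nonneg_left ?_ hK0
    obtain ⟨E, sE, -, hE, -, -⟩ := sn_max f.continuous n hα2
    obtain ⟨s, hs'⟩ := hs.hasRightInverse
    rw [← hE, ← Finset.card_image_of_injective E hs'.injective]
    have : (E.image s).card ≤ sn g n (δ / 2) := by
      refine card_le_sn g.continuous (by linarith) ?_
      intro x' hx y' hy hxy
      rw [Finset.coe_image] at hx hy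
      obtain ⟨x, hx, rfl⟩ := hx
      obtain ⟨y, hy, rfl⟩ := hy
      obtain ⟨j, hj, hdj⟩ := sE hx hy (fun h => hxy (by rw [h]))
      refine ⟨j, hj, ?_⟩
      by_contra hcon
      push Not at hcon
      have := hd (a := g^[j] (s x)) (b := g^[j] (s y)) (by linarith)
      rw [← hiter, ← hiter, hs', hs'] at this
      linarith
    exact_mod_cast this

end
end SamvaAux

set_option linter.unusedVariables false
set_option linter.unusedSectionVars false
open MeasureTheory Filter Topology Set
open scoped ENNReal NNReal
open Samva

namespace SamvaAux

lemma exists_pos_lb {ι : Type*} [Finite ι] (r : ι → ℝ) (hr : ∀ i, 0 < r i) : ∃ d > 0, ∀ i, d ≤ r i := by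
  rcases isEmpty_or_nonempty ι with h | h
  · exact ⟨1, one_pos, fun i => isEmptyElim i⟩
  · obtain ⟨i, hi⟩ := Finite.exists_min r
    exact ⟨r i, hr i, hi⟩

section
variable {X : Type*} [MetricSpace X] [CompactSpace X] [MeasurableSpace X] [BorelSpace X]

lemma exists_small (μ : Measure X) [IsProbabilityMeasure μ] {ι : Type*} [Fintype ι] {a : X → ι} (ha : FM a) {κ : ℝ}
    (hκ : 0 < κ) : ∃ w : X → Option ι, FM w ∧ Hf μ w ≤ κ ∧ ∃ r > 0, ∀ x y, w x = w y → dist x y < r → a x = a y := by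
  classical
  set c : ℝ := ((Fintype.card ι : ℕ) : ℝ) with hc
  have hc0 : 0 ≤ c := by positivity
  have hk : 0 < κ / (c + 1) := by positivity
  obtain ⟨t0, ht0, h0⟩ := Metric.continuous_iff.1 Real.continuous_negMulLog 0 _ hk
  obtain ⟨t1, ht1, h1⟩ := Metric.continuous_iff.1 Real.continuous_negMulLog 1 _ hk
  simp only [Real.negMulLog_zero, Real.negMulLog_one, Real.dist_eq, sub_zero] at h0 h1
  obtain ⟨θ, hθ, hθ0, hθ1⟩ : ∃ θ > 0, θ ≤ t0 ∧ c * θ < t1 := by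
    refine ⟨min t0 (t1 / (c + 1)), by positivity, min_le_left _ _, ?_⟩
    have : min t0 (t1 / (c + 1)) ≤ t1 / (c + 1) := min_le_right _ _
    have h2 : (c + 1) * (t1 / (c + 1)) = t1 := by field_simp
    have h3 : 0 < t1 / (c + 1) := by positivity
    nlinarith
  have hex : ∀ i, ∃ F ⊆ a ⁻¹' {i}, IsClosed F ∧ μ.real (a ⁻¹' {i} \ F) < θ := by
    intro i
    obtain ⟨F, hF, hFc, hFm⟩ := (ha i).exists_isClosed_sdiff_lt (μ := μ) (measure_ne_top _ _) (ε := ENNReal.ofReal θ) (by simpa using hθ)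
    refine ⟨F, hF, hFc, ?_⟩
    rw [Measure.real]
    exact (ENNReal.lt_ofReal_iff_toReal_lt (measure_ne_top _ _)).1 hFm
  choose F hF hFc hFm using hex
  let w : X → Option ι := fun x => if x ∈ F (a x) then none else some (a x)
  have hws : ∀ i, w ⁻¹' {some i} = a ⁻¹' {i} \ F i := by
    intro i; ext x
    simp only [w, mem_preimage, mem_singleton_iff, Set.mem_sdiff]
    split_ifs with h
    · simp; rintro rfl; exact h
    · simp; rintro rfl; exact h
  have hwn : w ⁻¹' {none} = ⋃ i, F i := by
    ext x
    simp only [w, mem_preimage, mem_singleton_iff, mem_iUnion]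
    split_ifs with h
    · simp; exact ⟨_, h⟩
    · simp; intro i hi; exact h (by have := hF i hi; rw [mem_preimage, mem_singleton_iff] at this; rwa [this])
  have hwF : FM w := by
    intro o
    cases o with
    | none => rw [hwn]; exact MeasurableSet.iUnion (fun i => (hFc i).measurableSet)
    | some i => rw [hws]; exact (ha i).diff (hFc i).measurableSet
  refine ⟨w, hwF, ?_, ?_⟩
  · unfold Hf
    rw [Fintype.sum_option]
    have hsum := sum_real_fiber μ hwF Finset.univ
    rw [Fintype.sum_option] at hsum
    simp only [Finset.coe_univ, preimage_univ, probReal_univ] at hsum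
    have hsm : ∑ i, μ.real (w ⁻¹' {some i}) ≤ c * θ := by
      calc _ ≤ ∑ i : ι, θ := Finset.sum_le_sum (fun i _ => by rw [hws]; exact (hFm i).le)
        _ = _ := by simp [hc]
    have hs0 : 0 ≤ ∑ i, μ.real (w ⁻¹' {some i}) := Finset.sum_nonneg (fun i _ => measureReal_nonneg)
    have e1 : Real.negMulLog (μ.real (w ⁻¹' {none})) ≤ κ / (c + 1) := by
      refine (le_abs_self _).trans (h1 _ ?_).le
      rw [abs_lt]; constructor <;> linarith
    have e2 : ∑ i, Real.negMulLog (μ.real (w ⁻¹' {some i})) ≤ c * (κ / (c + 1)) := by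
      calc _ ≤ ∑ i : ι, κ / (c + 1) := Finset.sum_le_sum (fun i _ => by
              refine (le_abs_self _).trans (h0 _ ?_).le
              rw [abs_of_nonneg measureReal_nonneg, hws]; exact (hFm i).trans_le hθ0)
        _ = _ := by simp [hc]
    calc _ ≤ κ / (c + 1) + c * (κ / (c + 1)) := by linarith
      _ = κ := by field_simp; ring
  · have hr : ∀ p : ι × ι, ∃ r > 0, p.1 ≠ p.2 → ∀ x ∈ F p.1, ∀ y ∈ F p.2, r ≤ dist x y := by
      rintro ⟨i, j⟩
      by_cases hij : i = j
      · exact ⟨1, one_pos, fun h => absurd hij h⟩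
      have hdis : Disjoint (F i) (F j) := by
        rw [Set.disjoint_left]
        intro x hx hy
        exact hij ((hF i hx).symm.trans (hF j hy))
      obtain ⟨δ, hδ, hd⟩ := hdis.exists_thickenings (hFc i).isCompact (hFc j)
      refine ⟨δ, hδ, fun _ x hx y hy => ?_⟩
      by_contra hlt
      push Not at hlt
      rw [Set.disjoint_left] at hd
      exact hd (a := y) (Metric.mem_thickening_iff.2 ⟨x, hx, by rwa [dist_comm]⟩) (Metric.self_subset_thickening hδ _ hy)
    choose r hr0 hr using hr
    obtain ⟨d, hd0, hd⟩ := exists_pos_lb r hr0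
    refine ⟨d, hd0, fun x y hwe hxy => ?_⟩
    by_contra hne
    have hx' : x ∈ F (a x) := by
      by_contra h; by_cases h2 : y ∈ F (a y) <;> simp [w, h, h2] at hwe
      exact hne hwe
    have hy' : y ∈ F (a y) := by
      by_contra h; simp [w, h, hx'] at hwe
    have := hr (a x, a y) hne x hx' y hy'
    have := hd (a x, a y)
    linarith

/-- generator bound -/
lemma entropy_gen (f : X ≃ₜ X) {α : ℝ} (ue : UE f α) (m : Measure X) [IsProbabilityMeasure m] (hinv : m.map f = m)
    {κ : Type*} [Fintype κ] {b : X → κ} (hb : FM b) {n : ℕ} (hn : 1 ≤ n)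
    (hd : ∀ x y, b x = b y → ∀ j < n, dist (f^[j] x) (f^[j] y) ≤ α) : mEntropy f m ≤ ((Hf m b / n : ℝ) : EReal) := by
  classical
  have hfm : Measurable f := f.continuous.measurable
  have hn0 : (0:ℝ) < n := by exact_mod_cast hn
  refine mEntropy_le m f _ ?_
  intro ι _ a ha δ hδ
  obtain ⟨w, hw, hwH, r, hr, hwr⟩ := exists_small m ha (κ := δ / 2) (by linarith)
  obtain ⟨N, hN⟩ := ue r hr
  set B := Hf m b with hB
  have hB0 : 0 ≤ B := Hf_nonneg m b
  -- number of blocks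
  obtain ⟨k, hk⟩ := exists_nat_gt (4 * (2 * N + 1) * B / δ)
  set k1 := k + 1 with hk1
  have hkn : 1 ≤ k1 * n := Nat.one_le_iff_ne_zero.2 (by positivity)
  refine ⟨k1 * n, hkn, ?_⟩
  -- the code
  let S : ℕ := k1 + 2 * N
  let bb : X → (Fin S → κ) := fun x i => b (f^[i.1 * n] x)
  let w1 : X → (Fin (k1 * n) → Option ι) := fun x i => w (f^[i.1 + N] x)
  have hbb : FM bb := FM.pi (fun i => hb.compMeas (hfm.iterate _))
  have hw1 : FM w1 := FM.pi (fun i => hw.compMeas (hfm.iterate _))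
  have hna : FM (nm f a (k1 * n) ∘ f^[N]) := (ha.nm hfm _).compMeas (hfm.iterate _)
  have key : Hf m (nm f a (k1 * n) ∘ f^[N]) ≤ Hf m (fun x => (bb x, w1 x)) + Real.log (1 : ℕ) := by
    refine Hf_le_of_mult m hna (hbb.prod hw1) 1 ?_
    intro j
    by_cases hj : ∃ x, (bb x, w1 x) = j
    · obtain ⟨x, hx⟩ := hj
      refine ⟨{(nm f a (k1 * n) ∘ f^[N]) x}, by simp, ?_⟩
      intro y hy
      rw [Finset.mem_singleton]
      rw [← hx, Prod.mk.injEq] at hy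
      have hclose : ∀ i < S * n, dist (f^[i] y) (f^[i] x) ≤ α := by
        intro i hi
        have hq : i / n < S := Nat.div_lt_of_lt_mul (by rwa [mul_comm] at hi)
        have e1 : b (f^[i / n * n] y) = b (f^[i / n * n] x) := congrFun hy.1 ⟨i / n, hq⟩
        have := hd _ _ e1 (i % n) (Nat.mod_lt _ hn)
        rwa [← Function.iterate_add_apply, ← Function.iterate_add_apply, Nat.mod_add_div' i n] at this
      funext i
      show a (f^[i.1] (f^[N] y)) = a (f^[i.1] (f^[N] x))
      rw [← Function.iterate_add_apply, ← Function.iterate_add_apply]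
      have hwi : w (f^[i.1 + N] y) = w (f^[i.1 + N] x) := congrFun hy.2 i
      refine hwr _ _ hwi ?_
      rw [show i.1 + N = N + i.1 by ring, Function.iterate_add_apply, Function.iterate_add_apply]
      refine hN _ _ (fun l hl => ?_)
      rw [← Function.iterate_add_apply, ← Function.iterate_add_apply]
      apply hclose
      have h1 := i.2
      have h2 : S * n = k1 * n + 2 * N * n := by simp only [S]; ring
      have h3 : 2 * N ≤ 2 * N * n := Nat.le_mul_of_pos_right _ hn
      omega
    · exact ⟨∅, by simp, fun x hx => absurd ⟨x, hx⟩ hj⟩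
  have e1 : Hf m (fun x => (bb x, w1 x)) ≤ Hf m bb + Hf m w1 := Hf_prod_le m hbb hw1
  have e2 : Hf m bb ≤ S * B := by
    refine (Hf_pi_le m (a := fun (i : Fin S) x => b (f^[i.1 * n] x)) (fun i => hb.compMeas (hfm.iterate _))).trans ?_
    have : ∀ i : Fin S, Hf m (fun x => b (f^[i.1 * n] x)) = B := fun i => Hf_iter hfm hinv hb _
    simp [this]
  have e3 : Hf m w1 ≤ (k1 * n : ℕ) * (δ / 2) := by
    refine (Hf_pi_le m (a := fun (i : Fin (k1 * n)) x => w (f^[i.1 + N] x)) (fun i => hw.compMeas (hfm.iterate _))).trans ?_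
    have : ∀ i : Fin (k1 * n), Hf m (fun x => w (f^[i.1 + N] x)) = Hf m w := fun i => Hf_iter hfm hinv hw _
    simp only [this, Finset.sum_const, Finset.card_univ, Fintype.card_fin, nsmul_eq_mul]
    gcongr
  have e4 : Hf m (nm f a (k1 * n) ∘ f^[N]) = DH m f a (k1 * n) := Hf_iter hfm hinv (ha.nm hfm _) N
  rw [e4] at key
  simp only [Nat.cast_one, Real.log_one, add_zero] at key
  have hk' : 2 * N * B ≤ k1 * (δ / 2) := by
    rw [div_lt_iff₀ hδ] at hk
    rw [hk1]; push_cast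
    nlinarith [Nat.cast_nonneg (α := ℝ) N]
  have hn1 : (1:ℝ) ≤ n := by exact_mod_cast hn
  have hk0 : (0:ℝ) ≤ k1 := by positivity
  calc DH m f a (k1 * n) ≤ S * B + (k1 * n : ℕ) * (δ / 2) := by linarith
    _ = k1 * B + 2 * N * B + k1 * n * (δ / 2) := by simp only [S]; push_cast; ring
    _ ≤ k1 * B + k1 * n * (δ / 2) + k1 * n * (δ / 2) := by
      have : k1 * (δ / 2) ≤ k1 * n * (δ / 2) := by
        have : (k1 : ℝ) ≤ k1 * n := by nlinarith
        gcongr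
      linarith
    _ = (B / n + δ) * (k1 * n : ℕ) := by push_cast; field_simp; ring

/-- adapted partition at scale `α/2` -/
lemma exists_part [Nonempty X] {f : X ≃ₜ X} (D : BD f) (n : ℕ) : ∃ (E : Finset X) (b : X → ↥E), FM b ∧ IsSep f n (D.α / 2) ↑E ∧
    E.card = sn f n (D.α / 2) ∧
    (∀ x, ∀ j < n, dist (f^[j] x) (f^[j] (b x : X)) ≤ D.α / 2) ∧
    (∀ x (e : ↥E), (∀ j < n, dist (f^[j] x) (f^[j] (e : X)) ≤ D.α / 4) → b x = e) ∧
    (∀ x y, b x = b y → ∀ j < n, dist (f^[j] x) (f^[j] y) ≤ D.α) := by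
  have hα2 : 0 < D.α / 2 := by have := D.hα; linarith
  obtain ⟨E, sE, -, hE, -, hsp⟩ := sn_max f.continuous n hα2
  obtain ⟨b, hb, h1, h2⟩ := exists_adapted f.continuous n E sE hsp
  refine ⟨E, b, hb, sE, hE, h1, fun x e he => h2 x e (fun j hj => (he j hj).trans (by linarith)), ?_⟩
  intro x y hxy j hj
  have a1 := h1 x j hj
  have a2 := h1 y j hj
  rw [← hxy] at a2
  have := dist_triangle_right (f^[j] x) (f^[j] y) (f^[j] (b x : X))
  linarith

lemma mEntropy_le_H [Nonempty X] {f : X ≃ₜ X} (D : BD f) (m : Measure X) [IsProbabilityMeasure m] (hinv : m.map f = m) :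
    mEntropy f m ≤ D.H := by
  refine EReal.le_of_forall_lt_iff_le.1 ?_
  intro z hz
  have hz' : D.H < z := by exact_mod_cast hz
  have ht : Tendsto (fun n : ℕ => Real.log D.K / n) atTop (𝓝 0) := tendsto_const_div_atTop_nhds_zero_nat _
  obtain ⟨n, hn, hn1⟩ := ((ht.eventually (gt_mem_nhds (show 0 < z - D.H by linarith))).and (eventually_ge_atTop 1)).exists
  have hn0 : (0:ℝ) < n := by exact_mod_cast hn1
  obtain ⟨E, b, hb, -, hc, -, -, hd⟩ := exists_part D n
  refine (entropy_gen f D.ue m hinv hb hn1 hd).trans ?_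
  rw [EReal.coe_le_coe_iff, div_le_iff₀ hn0]
  refine (Hf_le_log_card m hb).trans ?_
  rw [Fintype.card_coe, hc]
  have hs : (0:ℝ) < sn f n (D.α / 2) := by exact_mod_cast one_le_sn f.continuous n (by have := D.hα; linarith)
  have h3 := Real.log_le_log hs (D.up n)
  have hK : 0 < D.K := by have := D.hK; linarith
  rw [Real.log_mul hK.ne' (Real.exp_pos _).ne', Real.log_exp] at h3
  rw [div_lt_iff₀ hn0] at hn
  nlinarith

/-- zero entropy fibres do not add entropy -/
lemma mEntropy_lift [Nonempty X] {f g : X ≃ₜ X} {h : X → X} (hh : Continuous h) (hs : Function.Surjective h)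
    (hsemi : ∀ x, f (h x) = h (g x)) (H1 : ∀ x, relEntropy g (h ⁻¹' {h x}) = 0)
    (η : Measure X) [IsProbabilityMeasure η] (hinv : η.map g = η) (c : ℝ) (hc : mEntropy f (η.map h) ≤ c) :
    mEntropy g η ≤ c := by
  classical
  have hiter : ∀ k x, f^[k] (h x) = h (g^[k] x) := by
    intro k x
    exact ((show Function.Semiconj h g f from fun x => (hsemi x).symm).iterate_right k x).symm
  have hgm : Measurable g := g.continuous.measurable
  have hfm : Measurable f := f.continuous.measurable
  have hhm : Measurable h := hh.measurable
  have : IsProbabilityMeasure (η.map h) := Measure.isProbabilityMeasure_map hhm.aemeasurable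
  have hinvf : (η.map h).map f = η.map h := by
    rw [Measure.map_map hfm hhm, show ⇑f ∘ h = h ∘ ⇑g from funext hsemi, ← Measure.map_map hhm hgm, hinv]
  refine mEntropy_le η g c ?_
  intro ι _ a ha δ0 hδ0
  obtain ⟨w, hw, hwH, r, hr, hwr⟩ := exists_small η ha (κ := δ0 / 4) (by linarith)
  obtain ⟨δ, hδ, L, hcode⟩ := fiber_code (f := f) g.continuous hh hs hsemi H1 (ε := r / 2) (by linarith) (τ := δ0 / 4) (by linarith)
  obtain ⟨E, sE, -, -, -, hsp⟩ := sn_max f.continuous 1 (show 0 < δ / 2 by linarith)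
  obtain ⟨β, hβ, hβ1, -⟩ := exists_adapted f.continuous 1 E sE hsp
  have hβd : ∀ x y, β x = β y → dist x y ≤ δ := by
    intro x y hxy
    have a1 := hβ1 x 0 one_pos
    have a2 := hβ1 y 0 one_pos
    rw [← hxy] at a2
    simp only [Function.iterate_zero, id] at a1 a2
    have := dist_triangle_right x y (β x : X)
    linarith
  obtain ⟨N0, hN0⟩ := exists_nat_gt (L / (δ0 / 4))
  obtain ⟨n, hn1, hnN, hDH⟩ := exists_DH_le (η.map h) f hfm hinvf c hc hβ (δ0 / 4) (by linarith) N0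
  refine ⟨n, hn1, ?_⟩
  have hL : L ≤ (δ0 / 4) * n := by
    rw [div_lt_iff₀ (by linarith)] at hN0
    have : (N0 : ℝ) ≤ n := by exact_mod_cast hnN
    nlinarith
  choose cN hcN cc hcc using hcode n
  set N1 := ⌊Real.exp (δ0 / 4 * n + L)⌋₊ with hN1
  have hle : ∀ y, cN y ≤ N1 := fun y => Nat.le_floor (hcN y)
  have hb1 : FM (nm f β n ∘ h) := (hβ.nm hfm n).compMeas hhm
  have hb2 : FM (nm g w n) := hw.nm hgm n
  have key : Hf η (nm g a n) ≤ Hf η (fun x => ((nm f β n ∘ h) x, nm g w n x)) + Real.log N1 := by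
    refine Hf_le_of_mult η (ha.nm hgm n) (hb1.prod hb2) N1 ?_
    intro j
    by_cases hj : ∃ x, ((nm f β n ∘ h) x, nm g w n x) = j
    · obtain ⟨x0, hx0⟩ := hj
      have hcl : ∀ x, ((nm f β n ∘ h) x, nm g w n x) = j → ∀ i < n, dist (f^[i] (h x0)) (f^[i] (h x)) ≤ δ := by
        intro x hx i hi
        rw [← hx0, Prod.mk.injEq] at hx
        exact hβd _ _ (congrFun hx.1 ⟨i, hi⟩).symm
      have hdet : ∀ x y, ((nm f β n ∘ h) x, nm g w n x) = j → ((nm f β n ∘ h) y, nm g w n y) = j →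
          cc (h x0) x = cc (h x0) y → nm g a n x = nm g a n y := by
        intro x y hx hy hxy
        funext i
        refine hwr _ _ ?_ ?_
        · rw [← hy, Prod.mk.injEq] at hx
          exact congrFun hx.2 i
        · have := hcc (h x0) x y (hcl x hx) (hcl y hy) hxy i.1 i.2
          linarith
      let S : Set X := {x | ((nm f β n ∘ h) x, nm g w n x) = j}
      let rep : Fin (cN (h x0)) → (Fin n → ι) := fun q => if hq : ∃ x ∈ S, cc (h x0) x = q then nm g a n hq.choose else nm g a n x0
      refine ⟨Finset.univ.image rep, ?_, ?_⟩
      · refine Finset.card_image_le.trans ?_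
        rw [Finset.card_univ, Fintype.card_fin]; exact hle _
      · intro x hx
        rw [Finset.mem_image]
        refine ⟨cc (h x0) x, Finset.mem_univ _, ?_⟩
        have hq : ∃ x' ∈ S, cc (h x0) x' = cc (h x0) x := ⟨x, hx, rfl⟩
        simp only [rep, dif_pos hq]
        exact hdet _ _ hq.choose_spec.1 hx hq.choose_spec.2
    · exact ⟨∅, by simp, fun x hx => absurd ⟨x, hx⟩ hj⟩
  have e1 := Hf_prod_le η hb1 hb2
  have e2 : Hf η (nm f β n ∘ h) = DH (η.map h) f β n := Hf_comp_mp η hhm (hβ.nm hfm n)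
  have e3 : Hf η (nm g w n) ≤ n * (δ0 / 4) := (DH_le_mul hgm hinv hw n).trans (by gcongr)
  have e4 : Real.log N1 ≤ δ0 / 4 * n + L := by
    rcases Nat.eq_zero_or_pos N1 with h0 | h0
    · exfalso
      obtain ⟨x⟩ := ‹Nonempty X›
      have := (cc x x).pos
      have := hle x
      omega
    · rw [Real.log_le_iff_le_exp (by exact_mod_cast h0)]
      exact Nat.floor_le (Real.exp_pos _).le
  have : DH η g a n = Hf η (nm g a n) := rfl
  nlinarith

end
end SamvaAux

set_option linter.unusedVariables false
set_option linter.unusedSectionVars false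
open MeasureTheory Filter Topology Set
open scoped ENNReal NNReal
open Samva

namespace SamvaAux

section
variable {X : Type*} [MetricSpace X] [CompactSpace X] [MeasurableSpace X] [BorelSpace X]

lemma unif_real {s t : Set X} (hs : s.Finite) (ht : MeasurableSet t) :
    (ProbabilityTheory.uniformOn s).real t = ((s ∩ t).ncard : ℝ) / s.ncard := by
  rw [Measure.real, ProbabilityTheory.uniformOn, ProbabilityTheory.cond_apply hs.measurableSet,
    Measure.count_apply hs.measurableSet, Measure.count_apply (hs.measurableSet.inter ht),
    ← hs.cast_ncard_eq, ← (hs.inter_of_left t).cast_ncard_eq]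
  rw [ENNReal.toReal_mul, ENNReal.toReal_inv]
  simp only [ENat.toENNReal_coe, ENNReal.toReal_natCast]
  rw [div_eq_inv_mul]

lemma unif_map {s : Set X} (hs : s.Finite) {h : X → X} (hh : Measurable h) (hinj : InjOn h s) :
    (ProbabilityTheory.uniformOn s).map h = ProbabilityTheory.uniformOn (h '' s) := by
  rcases s.eq_empty_or_nonempty with rfl | hne
  · simp [ProbabilityTheory.uniformOn_empty_meas]
  have i1 := ProbabilityTheory.isProbabilityMeasure_uniformOn hs hne
  have i2 := ProbabilityTheory.isProbabilityMeasure_uniformOn (hs.image h) (hne.image h)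
  have i3 : IsProbabilityMeasure ((ProbabilityTheory.uniformOn s).map h) := Measure.isProbabilityMeasure_map hh.aemeasurable
  refine Measure.ext (fun t ht => ?_)
  rw [← ENNReal.toReal_eq_toReal_iff' (measure_ne_top _ _) (measure_ne_top _ _)]
  rw [Measure.map_apply hh ht]
  have e1 := unif_real hs (hh ht)
  have e2 := unif_real (hs.image h) ht
  rw [Measure.real] at e1 e2
  rw [e1, e2, hinj.ncard_image, ← image_inter_preimage, (hinj.mono inter_subset_left).ncard_image]

lemma unif_inv {s : Set X} (hs : s.Finite) (g : X ≃ₜ X) (hg : ∀ x ∈ s, g x ∈ s) :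
    (ProbabilityTheory.uniformOn s).map g = ProbabilityTheory.uniformOn s := by
  rw [unif_map hs g.continuous.measurable g.injective.injOn]
  congr 1
  refine Set.eq_of_subset_of_ncard_le (image_subset_iff.2 hg) ?_ hs
  rw [ncard_image_of_injective _ g.injective]

/-- bundling -/
noncomputable def mkP (μ : Measure X) [h : IsProbabilityMeasure μ] : ProbabilityMeasure X := ⟨μ, h⟩

lemma mkP_coe (μ : Measure X) [h : IsProbabilityMeasure μ] : ((mkP μ : ProbabilityMeasure X) : Measure X) = μ := rfl

lemma exists_seq_prob (μs : ℕ → Measure X) (μ : Measure X) [IsProbabilityMeasure μ]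
    (hp : ∀ᶠ n in atTop, IsProbabilityMeasure (μs n)) :
    ∃ p : ℕ → ProbabilityMeasure X, (∀ᶠ n in atTop, (p n : Measure X) = μs n) := by
  have : ∀ n, ∃ p : ProbabilityMeasure X, IsProbabilityMeasure (μs n) → (p : Measure X) = μs n := by
    intro n
    by_cases h : IsProbabilityMeasure (μs n)
    · exact ⟨mkP (μs n), fun _ => rfl⟩
    · exact ⟨mkP μ, fun h' => absurd h' h⟩
  choose p hpp using this
  refine ⟨p, ?_⟩
  filter_upwards [hp] with n hn
  exact hpp n hn

lemma weak_prob {μs : ℕ → Measure X} {μ : Measure X} [IsProbabilityMeasure μ]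
    (hp : ∀ᶠ n in atTop, IsProbabilityMeasure (μs n)) (hw : WeakLimit μs μ) :
    ∃ p : ℕ → ProbabilityMeasure X, (∀ᶠ n in atTop, (p n : Measure X) = μs n) ∧
      Tendsto p atTop (𝓝 (mkP μ)) := by
  obtain ⟨p, hpe⟩ := exists_seq_prob μs μ hp
  refine ⟨p, hpe, ?_⟩
  rw [ProbabilityMeasure.tendsto_iff_forall_integral_tendsto]
  intro φ
  refine (hw φ.toContinuousMap).congr' ?_
  filter_upwards [hpe] with n hn
  rw [hn]; rfl

lemma port_open {μs : ℕ → Measure X} {μ : Measure X} [IsProbabilityMeasure μ]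
    (hp : ∀ᶠ n in atTop, IsProbabilityMeasure (μs n)) (hw : WeakLimit μs μ) {U : Set X} (hU : IsOpen U) {c : ℝ}
    (h : ∀ᶠ n in atTop, (μs n).real U ≤ c) : μ.real U ≤ c := by
  obtain ⟨p, hpe, ht⟩ := weak_prob hp hw
  have h1 := ProbabilityMeasure.le_liminf_measure_open_of_tendsto ht hU
  have hc : 0 ≤ c := by
    obtain ⟨n, hn⟩ := h.exists
    exact measureReal_nonneg.trans hn
  have h2 : liminf (fun n => (p n : Measure X) U) atTop ≤ ENNReal.ofReal c := by
    refine liminf_le_of_frequently_le (Eventually.frequently ?_) (by isBoundedDefault)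
    filter_upwards [hpe, h] with n hn hh
    rw [← hn] at hh
    exact (ENNReal.le_ofReal_iff_toReal_le (measure_ne_top _ _) hc).2 hh
  have h3 := h1.trans h2
  exact (ENNReal.le_ofReal_iff_toReal_le (measure_ne_top _ _) hc).1 h3

lemma port_closed {μs : ℕ → Measure X} {μ : Measure X} [IsProbabilityMeasure μ]
    (hp : ∀ᶠ n in atTop, IsProbabilityMeasure (μs n)) (hw : WeakLimit μs μ) {F : Set X} (hF : IsClosed F) {c : ℝ}
    (h : ∀ᶠ n in atTop, c ≤ (μs n).real F) : c ≤ μ.real F := by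
  have := port_open hp hw hF.isOpen_compl (c := 1 - c) (by
    filter_upwards [hp, h] with n hn hh
    rw [probReal_compl_eq_one_sub hF.measurableSet]; linarith)
  rw [probReal_compl_eq_one_sub hF.measurableSet] at this
  linarith

lemma weak_inv {μs : ℕ → Measure X} {μ : Measure X} [IsProbabilityMeasure μ] (f : X ≃ₜ X)
    (hw : WeakLimit μs μ) (hi : ∀ᶠ n in atTop, (μs n).map f = μs n) : μ.map f = μ := by
  have hfm : Measurable f := f.continuous.measurable
  have : IsProbabilityMeasure (μ.map f) := Measure.isProbabilityMeasure_map hfm.aemeasurable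
  refine ext_of_forall_integral_eq_of_IsFiniteMeasure (fun φ => ?_)
  have h0 : ∀ ρ : Measure X, ∫ x, φ x ∂(ρ.map f) = ∫ x, φ (f x) ∂ρ := fun ρ =>
    integral_map hfm.aemeasurable φ.continuous.aestronglyMeasurable
  have h1 := hw (φ.toContinuousMap.comp ⟨f, f.continuous⟩)
  have h2 := hw φ.toContinuousMap
  rw [h0]
  refine tendsto_nhds_unique h1 (h2.congr' ?_)
  filter_upwards [hi] with n hn
  show ∫ x, φ x ∂(μs n) = ∫ x, φ (f x) ∂(μs n)
  rw [← h0, hn]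

lemma per_fin {f : X ≃ₜ X} (D : BD f) {n : ℕ} (hn : 1 ≤ n) : (perSet f n).Finite :=
  finite_of_sep f.continuous D.hα (per_sep D.ue hn)

lemma per_ne {f : X ≃ₜ X} (D : BD f) {n : ℕ} (hn : 3 * D.M ≤ n) : (perSet f n).Nonempty := by
  have h1 := D.perlo n hn
  rw [Set.nonempty_iff_ne_empty]
  intro h
  rw [h] at h1
  simp at h1
  have := Real.exp_pos (n * D.H)
  linarith

lemma per_prob {f : X ≃ₜ X} (D : BD f) : ∀ᶠ n in atTop, IsProbabilityMeasure (perMeasure f n) := by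
  filter_upwards [eventually_ge_atTop (3 * D.M), eventually_ge_atTop 1] with n h1 h2
  exact ProbabilityTheory.isProbabilityMeasure_uniformOn (per_fin D h2) (per_ne D h1)

lemma mu_inv {f : X ≃ₜ X} (D : BD f) {μ : Measure X} [IsProbabilityMeasure μ] (hμ : WeakLimit (perMeasure f) μ) :
    μ.map f = μ := by
  refine weak_inv f hμ ?_
  filter_upwards [eventually_ge_atTop 1] with n h2
  refine unif_inv (per_fin D h2) f ?_
  intro x hx
  show f^[n] (f x) = f x
  rw [← Function.iterate_succ_apply, Function.iterate_succ_apply', hx]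

end
end SamvaAux

set_option linter.unusedVariables false
set_option linter.unusedSectionVars false
open MeasureTheory Filter Topology Set
open scoped ENNReal NNReal
open Samva

namespace SamvaAux

section
variable {X : Type*} [MetricSpace X] [CompactSpace X] [MeasurableSpace X] [BorelSpace X]

lemma gibbs_up {f : X ≃ₜ X} (D : BD f) {μ : Measure X} [IsProbabilityMeasure μ] (hμ : WeakLimit (perMeasure f) μ)
    (n : ℕ) (x : X) :
    μ.real {y | ∀ j < n, dist (f^[j] x) (f^[j] y) < D.α / 2} ≤ D.K ^ 2 * Real.exp (-(n * D.H)) := by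
  have hα := D.hα
  have hK : 0 < D.K := by have := D.hK; linarith
  have hset : {y | ∀ j < n, dist (f^[j] x) (f^[j] y) < D.α / 2} = ⋂ j ∈ Finset.range n, {y | dist (f^[j] x) (f^[j] y) < D.α / 2} := by
    ext y; simp
  have hop : IsOpen {y | ∀ j < n, dist (f^[j] x) (f^[j] y) < D.α / 2} := by
    rw [hset]
    exact isOpen_biInter_finset (fun j _ => isOpen_lt (continuous_const.dist (f.continuous.iterate j)) continuous_const)
  refine port_open (per_prob D) hμ hop ?_
  filter_upwards [eventually_ge_atTop (3 * D.M), eventually_ge_atTop (n + 1)] with N h1 h2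
  have hN1 : 1 ≤ N := by omega
  rw [perMeasure, unif_real (per_fin D hN1) hop.measurableSet]
  set S := perSet f N ∩ {y | ∀ j < n, dist (f^[j] x) (f^[j] y) < D.α / 2} with hS
  have hinj : Function.Injective (f^[n]) := f.injective.iterate n
  have hsep : IsSep f (N - n) D.α (f^[n] '' S) := by
    rintro _ ⟨y, hy, rfl⟩ _ ⟨z, hz, rfl⟩ hyz
    obtain ⟨j, hj, hd⟩ := per_sep D.ue hN1 hy.1 hz.1 (fun h => hyz (by rw [h]))
    have hjn : n ≤ j := by
      by_contra hlt
      push Not at hlt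
      have a1 := hy.2 j hlt
      have a2 := hz.2 j hlt
      have := dist_triangle_left (f^[j] y) (f^[j] z) (f^[j] x)
      linarith
    refine ⟨j - n, by omega, ?_⟩
    rwa [← Function.iterate_add_apply, ← Function.iterate_add_apply, show j - n + n = j by omega]
  have hc := ncard_le_sn f.continuous hα hsep
  rw [ncard_image_of_injective _ hinj] at hc
  have hc2 : (S.ncard : ℝ) ≤ D.K * Real.exp ((N - n : ℕ) * D.H) := by
    refine le_trans ?_ (D.up (N - n))
    exact_mod_cast hc.trans (sn_anti f.continuous _ (by linarith) (by linarith))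
  have hl := D.perlo N h1
  have hpos : (0:ℝ) < (perSet f N).ncard := by
    have := Real.exp_pos (N * D.H)
    by_contra hneg
    push Not at hneg
    nlinarith
  rw [div_le_iff₀ hpos]
  refine hc2.trans ?_
  have e : Real.exp ((N - n : ℕ) * D.H) = Real.exp (-(n * D.H)) * Real.exp (N * D.H) := by
    rw [← Real.exp_add, Nat.cast_sub (by omega)]; congr 1; ring
  rw [e]
  have := mul_le_mul_of_nonneg_left hl (show 0 ≤ D.K * Real.exp (-(n * D.H)) by positivity)
  nlinarith

lemma glue_low {f : X ≃ₜ X} (D : BD f) {μ : Measure X} [IsProbabilityMeasure μ] (hμ : WeakLimit (perMeasure f) μ)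
    (n : ℕ) (x y : X) :
    (D.K ^ 2 * Real.exp (3 * D.M * D.H))⁻¹ * Real.exp (-(2 * n * D.H)) ≤ 
    μ.real {z | (∀ j < n, dist (f^[j] z) (f^[j] x) ≤ D.α / 4) ∧ ∀ j < n, dist (f^[n + D.M + j] z) (f^[j] y) ≤ D.α / 4} := by
  have hα := D.hα
  have hα2 : 0 < D.α / 2 := by linarith
  have hK : 0 < D.K := by have := D.hK; linarith
  set F := {z | (∀ j < n, dist (f^[j] z) (f^[j] x) ≤ D.α / 4) ∧ ∀ j < n, dist (f^[n + D.M + j] z) (f^[j] y) ≤ D.α / 4} with hF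
  have hset : F = (⋂ j ∈ Finset.range n, {z | dist (f^[j] z) (f^[j] x) ≤ D.α / 4}) ∩
      ⋂ j ∈ Finset.range n, {z | dist (f^[n + D.M + j] z) (f^[j] y) ≤ D.α / 4} := by
    ext z; simp [hF]
  have hcl : IsClosed F := by
    rw [hset]
    refine IsClosed.inter ?_ ?_
    · exact isClosed_biInter (fun j _ => isClosed_le ((f.continuous.iterate j).dist continuous_const) continuous_const)
    · exact isClosed_biInter (fun j _ => isClosed_le ((f.continuous.iterate _).dist continuous_const) continuous_const)
  refine port_closed (per_prob D) hμ hcl ?_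
  filter_upwards [eventually_ge_atTop (2 * n + 3 * D.M), eventually_ge_atTop 1] with N h1 hN1
  rw [perMeasure, unif_real (per_fin D hN1) hcl.measurableSet]
  obtain ⟨n3, hn3⟩ : ∃ n3, N = n + n + n3 + 3 * D.M := ⟨N - 2 * n - 3 * D.M, by omega⟩
  obtain ⟨E, sE, -, hE, -, -⟩ := sn_max f.continuous n3 hα2
  choose z hz1 hz2 hz3 hz4 using fun e => D.spec n n n3 x y e
  have hinj : InjOn z E := by
    intro e he e' he' hee
    by_contra hne
    obtain ⟨j, hj, hd⟩ := sE he he' hne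
    have a1 := hz4 e j hj.le
    have a2 := hz4 e' j hj.le
    rw [← hee] at a2
    have := dist_triangle_left (f^[j] e) (f^[j] e') (f^[n + n + 2 * D.M + j] (z e))
    linarith
  have hsub : z '' E ⊆ perSet f N ∩ F := by
    rintro _ ⟨e, he, rfl⟩
    refine ⟨?_, fun j hj => hz2 e j hj.le, fun j hj => hz3 e j hj.le⟩
    show f^[N] (z e) = z e
    rw [hn3]; exact hz1 e
  have hc : sn f n3 (D.α / 2) ≤ (perSet f N ∩ F).ncard := by
    rw [← hE, ← Set.ncard_coe_finset, ← hinj.ncard_image]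
    exact Set.ncard_le_ncard hsub ((per_fin D hN1).inter_of_left _)
  have hup := D.perup N hN1
  have hlo := D.lo n3
  have hpos : (0:ℝ) < (perSet f N).ncard := by
    have := (Set.ncard_pos (per_fin D hN1)).2 (per_ne D (by omega))
    exact_mod_cast this
  rw [le_div_iff₀ hpos]
  have hc' : (sn f n3 (D.α / 2) : ℝ) ≤ (perSet f N ∩ F).ncard := by exact_mod_cast hc
  refine le_trans ?_ hc'
  have e : Real.exp (-(2 * n * D.H)) * Real.exp (N * D.H) = Real.exp (3 * D.M * D.H) * Real.exp (n3 * D.H) := by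
    rw [← Real.exp_add, ← Real.exp_add, hn3]; push_cast; congr 1; ring
  have hp3 := Real.exp_pos (3 * D.M * D.H)
  have hp2 := Real.exp_pos (-(2 * n * D.H))
  rw [mul_assoc, inv_mul_le_iff₀ (by positivity)]
  calc Real.exp (-(2 * n * D.H)) * ((perSet f N).ncard : ℝ) ≤ Real.exp (-(2 * n * D.H)) * (D.K * Real.exp (N * D.H)) := by gcongr
    _ = D.K * Real.exp (3 * D.M * D.H) * Real.exp (n3 * D.H) := by linear_combination D.K * e
    _ ≤ D.K * Real.exp (3 * D.M * D.H) * (D.K * sn f n3 (D.α / 2)) := by gcongr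
    _ = _ := by ring

lemma Hf_ge (μ : Measure X) [IsProbabilityMeasure μ] {ι : Type*} [Fintype ι] {a : X → ι} (ha : FM a) {q : ℝ} (hq : 0 < q)
    (h : ∀ i, μ.real (a ⁻¹' {i}) ≤ q) : - Real.log q ≤ Hf μ a := by
  have hs := sum_real_fiber μ ha Finset.univ
  simp only [Finset.coe_univ, preimage_univ, probReal_univ] at hs
  calc - Real.log q = ∑ i, μ.real (a ⁻¹' {i}) * (- Real.log q) := by rw [← Finset.sum_mul, hs, one_mul]
    _ ≤ _ := by
      refine Finset.sum_le_sum (fun i _ => ?_)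
      have h0 : 0 ≤ μ.real (a ⁻¹' {i}) := measureReal_nonneg
      rcases h0.eq_or_lt with h0 | h0
      · rw [← h0]; simp
      · have := Real.log_le_log h0 (h i)
        rw [Real.negMulLog]
        nlinarith

lemma exists_gen [Nonempty X] {f : X ≃ₜ X} (D : BD f) {μ : Measure X} [IsProbabilityMeasure μ] (hμ : WeakLimit (perMeasure f) μ) :
    ∃ (E : Finset X) (a : X → ↥E), FM a ∧ ∀ n, 1 ≤ n → D.H * n ≤ DH μ f a n := by
  have hα := D.hα
  have hfm : Measurable f := f.continuous.measurable
  have hK : 1 ≤ D.K := D.hK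
  obtain ⟨E, sE, -, -, -, hsp⟩ := sn_max f.continuous 1 (show 0 < D.α / 5 by linarith)
  obtain ⟨a, ha, ha1, -⟩ := exists_adapted f.continuous 1 E sE hsp
  refine ⟨E, a, ha, ?_⟩
  have had : ∀ x y, a x = a y → dist x y < D.α / 2 := by
    intro x y hxy
    have a1 := ha1 x 0 one_pos
    have a2 := ha1 y 0 one_pos
    rw [← hxy] at a2
    simp only [Function.iterate_zero, id] at a1 a2
    have := dist_triangle_right x y (a x : X)
    linarith
  have hb : ∀ n, D.H * n - Real.log (D.K ^ 2) ≤ DH μ f a n := by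
    intro n
    have hq : 0 < D.K ^ 2 * Real.exp (-(n * D.H)) := by positivity
    have := Hf_ge μ (ha.nm hfm n) hq (fun i => by
      by_cases hne : ∃ x, nm f a n x = i
      · obtain ⟨x, hx⟩ := hne
        refine le_trans (measureReal_mono ?_) (gibbs_up D hμ n x)
        intro y hy j hj
        rw [mem_preimage, mem_singleton_iff, ← hx] at hy
        exact had _ _ (congrFun hy ⟨j, hj⟩).symm
      · have : nm f a n ⁻¹' {i} = ∅ := by
          ext y; simp; exact fun h => hne ⟨y, h⟩
        rw [this]; simp; positivity)
    rw [Real.log_mul (by positivity) (Real.exp_pos _).ne', Real.log_exp] at this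
    rw [DH]; linarith
  intro n hn
  by_contra hlt
  push Not at hlt
  obtain ⟨k, hk⟩ := exists_nat_gt (Real.log (D.K ^ 2) / (D.H * n - DH μ f a n))
  rw [div_lt_iff₀ (by linarith)] at hk
  have h1 := DH_mul_le hfm (mu_inv D hμ) ha k n
  have h2 := hb (k * n)
  push_cast at h2
  nlinarith

end
end SamvaAux

set_option linter.unusedVariables false
set_option linter.unusedSectionVars false
open MeasureTheory Filter Topology Set
open scoped ENNReal NNReal
open Samva

namespace SamvaAux

section
variable {X : Type*} [MetricSpace X] [CompactSpace X] [MeasurableSpace X] [BorelSpace X]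

lemma card_low (m : Measure X) [IsProbabilityMeasure m] {ι : Type*} [Fintype ι] {b : X → ι} (hb : FM b)
    [DecidableEq ι] (s : Finset ι) {n : ℕ} {H K t : ℝ} (hK : 1 ≤ K) (ht : 0 < t) (hH : n * H ≤ Hf m b)
    (hcard : (Fintype.card ι : ℝ) ≤ K * Real.exp (n * H)) (hts : t ≤ m.real (b ⁻¹' s)) :
    Real.exp (-((Real.log 2 + Real.log K) / t)) * Real.exp (n * H) ≤ s.card := by
  have hsp := Hf_split m hb s
  set p := m.real (b ⁻¹' s) with hp
  have hp1 : p ≤ 1 := measureReal_le_one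
  have hsne : s.Nonempty := by
    rw [Finset.nonempty_iff_ne_empty]
    rintro rfl
    simp at hp
    linarith
  have hspos : (0:ℝ) < s.card := by exact_mod_cast hsne.card_pos
  have hι : 1 ≤ Fintype.card ι := hsne.card_pos.trans_le (Finset.card_le_univ s)
  have hlogι : Real.log (Fintype.card ι) ≤ Real.log K + n * H := by
    have := Real.log_le_log (by exact_mod_cast hι) hcard
    rwa [Real.log_mul (by linarith) (Real.exp_pos _).ne', Real.log_exp] at this
  have hlogc : Real.log (sᶜ.card) ≤ Real.log (Fintype.card ι) := by
    rcases Nat.eq_zero_or_pos sᶜ.card with h0 | h0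
    · rw [h0]; simp; exact Real.log_nonneg (by exact_mod_cast hι)
    · exact Real.log_le_log (by exact_mod_cast h0) (by exact_mod_cast Finset.card_le_univ _)
  have hlK : 0 ≤ Real.log K := Real.log_nonneg hK
  have hl2 : 0 ≤ Real.log 2 := Real.log_nonneg (by norm_num)
  rw [← Real.exp_add, ← Real.le_log_iff_exp_le hspos]
  have h1 : (1 - p) * Real.log (sᶜ.card) ≤ (1 - p) * (Real.log K + n * H) :=
    mul_le_mul_of_nonneg_left (hlogc.trans hlogι) (by linarith)
  have hp0 : 0 < p := by linarith
  have h2 : p * (n * H - Real.log s.card) ≤ Real.log 2 + Real.log K := by nlinarith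
  by_contra hcon
  push Not at hcon
  have h3 : (Real.log 2 + Real.log K) / t < n * H - Real.log s.card := by linarith
  have h4 : 0 ≤ (Real.log 2 + Real.log K) / t := by positivity
  rw [div_lt_iff₀ ht] at h3
  nlinarith

lemma H_le_Hf {f : X ≃ₜ X} (D : BD f) (m : Measure X) [IsProbabilityMeasure m] (hinv : m.map f = m)
    (hm : (D.H : EReal) ≤ mEntropy f m) {κ : Type*} [Fintype κ] {b : X → κ} (hb : FM b) {n : ℕ} (hn : 1 ≤ n)
    (hd : ∀ x y, b x = b y → ∀ j < n, dist (f^[j] x) (f^[j] y) ≤ D.α) : n * D.H ≤ Hf m b := by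
  have := hm.trans (entropy_gen f D.ue m hinv hb hn hd)
  rw [EReal.coe_le_coe_iff, le_div_iff₀ (by exact_mod_cast hn)] at this
  linarith

lemma inv_sub {m : Measure X} [IsProbabilityMeasure m] {f : X ≃ₜ X} (hinv : m.map f = m) (N : ℕ) {B C : Set X}
    (hC : MeasurableSet C) (h : ∀ x ∈ B, f^[N] x ∈ C) {κ : ℝ} (hk : m.real C < κ) : m.real B < κ := by
  have h1 := map_iterate_inv f.continuous.measurable hinv N
  have h2 : m.real (f^[N] ⁻¹' C) = m.real C := by
    conv_rhs => rw [← h1]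
    rw [map_measureReal_apply (f.continuous.measurable.iterate N) hC]
  exact (measureReal_mono (show B ⊆ f^[N] ⁻¹' C from h)).trans_lt (h2.trans_lt hk)

lemma dichotomy [Nonempty X] {f : X ≃ₜ X} (D : BD f) {μ : Measure X} [IsProbabilityMeasure μ] (hμ : WeakLimit (perMeasure f) μ)
    (m m' : Measure X) [IsProbabilityMeasure m] [IsProbabilityMeasure m'] (hm : m.map f = m) (hm' : m'.map f = m')
    (hme : (D.H : EReal) ≤ mEntropy f m) (hme' : (D.H : EReal) ≤ mEntropy f m') {A : Set X} (hA : MeasurableSet A)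
    (hAi : f ⁻¹' A = A) (h1 : m A ≠ 0) (h2 : m' Aᶜ ≠ 0) : False := by
  classical
  have hμi := mu_inv D hμ
  have hK : 1 ≤ D.K := D.hK
  have hAit : ∀ (N : ℕ) x, f^[N] x ∈ A ↔ x ∈ A := by
    intro N x
    induction N with
    | zero => rfl
    | succ N ih => rw [Function.iterate_succ_apply', ← ih]; exact Set.ext_iff.1 hAi _
  have p1 : 0 < m.real A := ENNReal.toReal_pos h1 (measure_ne_top _ _)
  have p2 : 0 < m'.real Aᶜ := ENNReal.toReal_pos h2 (measure_ne_top _ _)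
  obtain ⟨t, ht, ht1, ht2⟩ : ∃ t > 0, 2 * t ≤ m.real A ∧ 2 * t ≤ m'.real Aᶜ :=
    ⟨min (m.real A) (m'.real Aᶜ) / 2, by positivity, by linarith [min_le_left (m.real A) (m'.real Aᶜ)],
      by linarith [min_le_right (m.real A) (m'.real Aᶜ)]⟩
  set c1 := Real.exp (-((Real.log 2 + Real.log D.K) / t)) with hc1
  have hc1p : 0 < c1 := Real.exp_pos _
  set c2 := (D.K ^ 2 * Real.exp (3 * D.M * D.H))⁻¹ with hc2
  have hc2p : 0 < c2 := by positivity
  obtain ⟨κ, hκ, hκt, hκc⟩ : ∃ κ > 0, κ ≤ t ∧ 2 * κ ≤ c2 * c1 ^ 2 :=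
    ⟨min t (c2 * c1 ^ 2 / 2), by positivity, min_le_left _ _, by linarith [min_le_right t (c2 * c1 ^ 2 / 2)]⟩
  let ρ : Measure X := m + m' + μ
  have hle : ∀ B, ρ B < ENNReal.ofReal κ → m.real B < κ ∧ m'.real B < κ ∧ μ.real B < κ := by
    intro B hB
    have e : ρ B = m B + m' B + μ B := by simp [ρ]
    rw [e] at hB
    refine ⟨?_, ?_, ?_⟩
    · exact (ENNReal.lt_ofReal_iff_toReal_lt (measure_ne_top _ _)).1 (lt_of_le_of_lt (by rw [add_assoc]; exact le_self_add) hB)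
    · exact (ENNReal.lt_ofReal_iff_toReal_lt (measure_ne_top _ _)).1 (lt_of_le_of_lt (le_trans le_add_self le_self_add) hB)
    · exact (ENNReal.lt_ofReal_iff_toReal_lt (measure_ne_top _ _)).1 (lt_of_le_of_lt le_add_self hB)
  obtain ⟨F, hFA, hFc, hFm⟩ := hA.exists_isClosed_sdiff_lt (μ := ρ) (measure_ne_top _ _) (ε := ENNReal.ofReal κ) (by simpa using hκ)
  obtain ⟨G, hGA, hGc, hGm⟩ := hA.compl.exists_isClosed_sdiff_lt (μ := ρ) (measure_ne_top _ _) (ε := ENNReal.ofReal κ) (by simpa using hκ)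
  have hFm' := hle _ hFm
  have hGm' := hle _ hGm
  have hFmeas : MeasurableSet (A \ F) := hA.diff hFc.measurableSet
  have hGmeas : MeasurableSet (Aᶜ \ G) := hA.compl.diff hGc.measurableSet
  have hdis : Disjoint F G := by
    rw [Set.disjoint_left]; intro x hx hy; exact hGA hy (hFA hx)
  obtain ⟨r, hr, hd⟩ := hdis.exists_thickenings hFc.isCompact hGc
  have hFG : ∀ x ∈ F, ∀ y ∈ G, r ≤ dist x y := by
    intro x hx y hy
    by_contra hlt
    push Not at hlt
    rw [Set.disjoint_left] at hd
    exact hd (a := y) (Metric.mem_thickening_iff.2 ⟨x, hx, by rwa [dist_comm]⟩) (Metric.self_subset_thickening hr _ hy)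
  obtain ⟨N, hN⟩ := D.ue r hr
  set n := 2 * N + 1 with hn
  obtain ⟨E, b, hb, -, hEc, -, hb4, hbd⟩ := exists_part D n
  let C : Finset ↥E := Finset.univ.filter (fun e => ∃ x, b x = e ∧ f^[N] x ∈ F)
  have s1 : ∀ x ∈ b ⁻¹' (C : Set ↥E) \ A, f^[N] x ∈ Aᶜ \ G := by
    rintro x ⟨hx, hxA⟩
    refine ⟨fun h => hxA ((hAit N x).1 h), fun hG => ?_⟩
    simp only [C, mem_preimage, Finset.coe_filter, Finset.mem_univ, true_and, mem_setOf_eq] at hx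
    obtain ⟨x', hx', hxF⟩ := hx
    have := hN x' x (fun i hi => hbd _ _ hx' i (by omega))
    have := hFG _ hxF _ hG
    linarith
  have s2 : ∀ x ∈ A \ b ⁻¹' (C : Set ↥E), f^[N] x ∈ A \ F := by
    rintro x ⟨hxA, hx⟩
    refine ⟨(hAit N x).2 hxA, fun hF => hx ?_⟩
    simp only [C, mem_preimage, Finset.coe_filter, Finset.mem_univ, true_and, mem_setOf_eq]
    exact ⟨x, rfl, hF⟩
  have hCm : MeasurableSet (b ⁻¹' (C : Set ↥E)) := hb.preimage _
  have hcardE : (Fintype.card ↥E : ℝ) ≤ D.K * Real.exp (n * D.H) := by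
    rw [Fintype.card_coe, hEc]; exact D.up n
  have hpre : b ⁻¹' ((Cᶜ : Finset ↥E) : Set ↥E) = (b ⁻¹' (C : Set ↥E))ᶜ := by
    rw [Finset.coe_compl, preimage_compl]
  have q1 : t ≤ m.real (b ⁻¹' (C : Set ↥E)) := by
    have a1 := inv_sub hm N hFmeas s2 hFm'.1
    have a2 : m.real A ≤ m.real (b ⁻¹' (C : Set ↥E)) + m.real (A \ b ⁻¹' (C : Set ↥E)) := by
      refine le_trans (measureReal_mono ?_) (measureReal_union_le _ _)
      intro x hx
      by_cases h : x ∈ b ⁻¹' (C : Set ↥E)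
      · exact Or.inl h
      · exact Or.inr ⟨hx, h⟩
    linarith
  have q2 : t ≤ m'.real (b ⁻¹' ((Cᶜ : Finset ↥E) : Set ↥E)) := by
    rw [hpre]
    have a1 := inv_sub hm' N hGmeas s1 hGm'.2.1
    have a2 : m'.real Aᶜ ≤ m'.real (b ⁻¹' (C : Set ↥E))ᶜ + m'.real (b ⁻¹' (C : Set ↥E) \ A) := by
      refine le_trans (measureReal_mono ?_) (measureReal_union_le _ _)
      intro x hx
      by_cases h : x ∈ b ⁻¹' (C : Set ↥E)
      · exact Or.inr ⟨h, hx⟩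
      · exact Or.inl h
    linarith
  have n1 : 1 ≤ n := by omega
  have k1 := card_low m hb C hK ht (H_le_Hf D m hm hme hb n1 hbd) hcardE q1
  have k2 := card_low m' hb Cᶜ hK ht (H_le_Hf D m' hm' hme' hb n1 hbd) hcardE q2
  -- glue
  let bb : X → ↥E × ↥E := fun z => (b z, b (f^[n + D.M] z))
  have hbb : FM bb := hb.prod (hb.compMeas (f.continuous.measurable.iterate _))
  have hsum := sum_real_fiber μ hbb (C ×ˢ Cᶜ)
  have hlow : (C.card : ℝ) * (Cᶜ.card : ℝ) * (c2 * Real.exp (-(2 * n * D.H))) ≤ μ.real (bb ⁻¹' ((C ×ˢ Cᶜ : Finset _) : Set (↥E × ↥E))) := by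
    rw [← hsum]
    calc _ = ∑ p ∈ C ×ˢ Cᶜ, c2 * Real.exp (-(2 * n * D.H)) := by
          rw [Finset.sum_const, Finset.card_product, nsmul_eq_mul]; push_cast; ring
      _ ≤ _ := by
        refine Finset.sum_le_sum (fun p _ => ?_)
        refine (glue_low D hμ n (p.1 : X) (p.2 : X)).trans (measureReal_mono ?_)
        rintro z ⟨hz1, hz2⟩
        rw [mem_preimage, mem_singleton_iff]
        refine Prod.ext (hb4 z p.1 hz1) (hb4 _ p.2 (fun j hj => ?_))
        rw [← Function.iterate_add_apply, add_comm j]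
        exact hz2 j hj
  have hupp : μ.real (bb ⁻¹' ((C ×ˢ Cᶜ : Finset _) : Set (↥E × ↥E))) < 2 * κ := by
    have a1 := inv_sub hμi N hGmeas s1 hGm'.2.2
    have a2 := inv_sub hμi N hFmeas s2 hFm'.2.2
    have a3 : μ.real (f^[n + D.M] ⁻¹' (A \ b ⁻¹' (C : Set ↥E))) < κ :=
      inv_sub hμi (n + D.M) (hA.diff hCm) (fun x hx => hx) a2
    have : μ.real (bb ⁻¹' ((C ×ˢ Cᶜ : Finset _) : Set (↥E × ↥E))) ≤ μ.real (b ⁻¹' (C : Set ↥E) \ A) + μ.real (f^[n + D.M] ⁻¹' (A \ b ⁻¹' (C : Set ↥E))) := by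
      refine le_trans (measureReal_mono ?_) (measureReal_union_le _ _)
      intro z hz
      simp only [bb, mem_preimage, Finset.coe_product, mem_prod, Finset.coe_compl, mem_compl_iff] at hz
      by_cases h : z ∈ A
      · exact Or.inr ⟨(hAit _ z).2 h, hz.2⟩
      · exact Or.inl ⟨hz.1, h⟩
    linarith
  have hfin : c2 * c1 ^ 2 ≤ (C.card : ℝ) * (Cᶜ.card : ℝ) * (c2 * Real.exp (-(2 * n * D.H))) := by
    have e : Real.exp (n * D.H) * Real.exp (n * D.H) * Real.exp (-(2 * n * D.H)) = 1 := by
      rw [← Real.exp_add, ← Real.exp_add, ← Real.exp_zero]; congr 1; ring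
    calc c2 * c1 ^ 2 = (c1 * Real.exp (n * D.H)) * (c1 * Real.exp (n * D.H)) * (c2 * Real.exp (-(2 * n * D.H))) := by
          linear_combination (-c2 * c1 ^ 2) * e
      _ ≤ _ := by gcongr
  linarith

lemma mu_entropy [Nonempty X] {f : X ≃ₜ X} (D : BD f) {μ : Measure X} [IsProbabilityMeasure μ] (hμ : WeakLimit (perMeasure f) μ) :
    (D.H : EReal) ≤ mEntropy f μ := by
  obtain ⟨E, a, ha, h⟩ := exists_gen D hμ
  exact le_mEntropy μ f f.continuous.measurable D.H ha h

lemma mu_ergodic [Nonempty X] {f : X ≃ₜ X} (D : BD f) {μ : Measure X} [IsProbabilityMeasure μ] (hμ : WeakLimit (perMeasure f) μ) :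
    Ergodic f μ := by
  have hi := mu_inv D hμ
  have he := mu_entropy D hμ
  refine { measurable := f.continuous.measurable, map_eq := hi, aeconst_set := ?_ }
  intro A hA hAi
  rw [eventuallyConst_set']
  by_contra hcon
  push Not at hcon
  refine dichotomy D hμ μ μ hi hi he he hA hAi (fun h => hcon.1 ?_) (fun h => hcon.2 ?_)
  · exact ae_eq_empty.2 h
  · exact ae_eq_univ.2 h

lemma mme_unique [Nonempty X] {f : X ≃ₜ X} (D : BD f) {μ : Measure X} [IsProbabilityMeasure μ] (hμ : WeakLimit (perMeasure f) μ)
    (m : Measure X) [IsProbabilityMeasure m] (hm : m.map f = m) (hme : (D.H : EReal) ≤ mEntropy f m) : m = μ := by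
  have hi := mu_inv D hμ
  have he := mu_entropy D hμ
  have hfm : Measurable f := f.continuous.measurable
  have mp : MeasurePreserving f m m := ⟨hfm, hm⟩
  have mpμ : MeasurePreserving f μ μ := ⟨hfm, hi⟩
  refine (mu_ergodic D hμ).eq_of_absolutelyContinuous mp ?_
  refine Measure.AbsolutelyContinuous.mk (fun B hB hB0 => ?_)
  let A : Set X := ⋂ N : ℕ, ⋃ n : ℕ, ⋃ _ : N ≤ n, f^[n] ⁻¹' B
  have hAm : MeasurableSet A := MeasurableSet.iInter (fun N => MeasurableSet.iUnion (fun n => MeasurableSet.iUnion (fun _ => (hfm.iterate n) hB)))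
  have hmem : ∀ x, x ∈ A ↔ ∀ N : ℕ, ∃ n, N ≤ n ∧ f^[n] x ∈ B := by
    intro x; simp [A]
  have hAi : f ⁻¹' A = A := by
    ext x
    rw [mem_preimage, hmem, hmem]
    constructor
    · intro h N
      obtain ⟨n, hn, hx⟩ := h N
      exact ⟨n + 1, by omega, by rwa [Function.iterate_succ_apply]⟩
    · intro h N
      obtain ⟨n, hn, hx⟩ := h (N + 1)
      refine ⟨n - 1, by omega, ?_⟩
      rwa [← Function.iterate_succ_apply, show (n - 1).succ = n by omega]
  have hμA : μ A = 0 := by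
    refine measure_mono_null (t := ⋃ n : ℕ, f^[n] ⁻¹' B) ?_ ?_
    · intro x hx
      obtain ⟨n, -, hn⟩ := (hmem x).1 hx 0
      exact mem_iUnion.2 ⟨n, hn⟩
    · refine measure_iUnion_null (fun n => ?_)
      rw [(mpμ.iterate n).measure_preimage hB.nullMeasurableSet, hB0]
  by_cases hmA : m A = 0
  · have hrec := mp.conservative.ae_mem_imp_frequently_image_mem hB.nullMeasurableSet
    refine measure_mono_null (t := A ∪ {x | ¬ (x ∈ B → ∃ᶠ n in atTop, f^[n] x ∈ B)}) ?_ (measure_union_null hmA hrec)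
    intro x hx
    by_cases hf : ∃ᶠ n in atTop, f^[n] x ∈ B
    · refine Or.inl ((hmem x).2 (fun N => ?_))
      obtain ⟨n, hn, h⟩ := frequently_atTop.1 hf N
      exact ⟨n, hn, h⟩
    · refine Or.inr ?_
      simp only [mem_setOf_eq]
      exact fun h => hf (h hx)
  · exfalso
    refine dichotomy D hμ m μ hm hi hme he hAm hAi hmA ?_
    rw [prob_compl_eq_one_sub hAm, hμA]; simp

end
end SamvaAux

set_option linter.unusedVariables false
set_option linter.unusedSectionVars false
open MeasureTheory Filter Topology Set
open scoped ENNReal NNReal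
open Samva
namespace SamvaAux
section
variable {X : Type*} [MetricSpace X] [CompactSpace X] [MeasurableSpace X] [BorelSpace X]

lemma null_of_disj {μ : Measure X} [IsProbabilityMeasure μ] {T C : Set X} (hT : μ T = 1) (hC : MeasurableSet C)
    (hd : ∀ x ∈ C, x ∉ T) : μ C = 0 := by
  rw [← prob_compl_eq_one_iff hC]
  refine le_antisymm prob_le_one (hT ▸ measure_mono (fun x hx hc => hd x hc hx))

lemma lift_closed {h : X → X} (hh : Continuous h) {μ : Measure X} [IsProbabilityMeasure μ] (H3 : HypH3 h μ)
    (η : Measure X) [IsProbabilityMeasure η] (hη : η.map h = μ) {F : Set X} (hF : IsClosed F) :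
    η F = μ (h '' F) := by
  rcases F.eq_empty_or_nonempty with rfl | hne
  · simp
  have hhF : IsClosed (h '' F) := (hF.isCompact.image hh).isClosed
  rw [← hη, Measure.map_apply hh.measurable hhF.measurableSet]
  refine le_antisymm (measure_mono (subset_preimage_image h F)) ?_
  set G : ℕ → Set X := fun k => h ⁻¹' (h '' F) ∩ {x | 1 / ((k:ℝ) + 1) ≤ Metric.infDist x F} with hG
  have hGc : ∀ k, IsClosed (G k) := fun k => (hhF.preimage hh).inter
    (isClosed_le continuous_const (Metric.continuous_infDist_pt F))
  have hsub : h ⁻¹' (h '' F) ⊆ F ∪ ⋃ k, G k := by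
    intro x hx
    by_cases hxF : x ∈ F
    · exact Or.inl hxF
    · right
      have hpos := (hF.notMem_iff_infDist_pos hne).1 hxF
      obtain ⟨k, hk⟩ := exists_nat_one_div_lt hpos
      exact mem_iUnion.2 ⟨k, hx, hk.le⟩
  have hnull : ∀ k, η (G k) = 0 := by
    intro k
    have hcl : IsClosed (h '' G k) := ((hGc k).isCompact.image hh).isClosed
    have h0 : μ (h '' G k) = 0 := by
      refine null_of_disj H3 hcl.measurableSet ?_
      rintro _ ⟨x, ⟨⟨y, hyF, hy⟩, hx2⟩, rfl⟩ ⟨z, hz⟩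
      have e1 : x = z := by
        have : x ∈ h ⁻¹' {h x} := rfl
        rw [hz] at this; exact this
      have e2 : y = z := by
        have : y ∈ h ⁻¹' {h x} := hy
        rw [hz] at this; exact this
      have hxF : x ∈ F := by rw [e1, ← e2]; exact hyF
      have hx2' : 1 / ((k:ℝ) + 1) ≤ Metric.infDist x F := hx2
      rw [Metric.infDist_zero_of_mem hxF] at hx2'
      have : 0 < 1 / ((k:ℝ) + 1) := by positivity
      linarith
    rw [← hη, Measure.map_apply hh.measurable hcl.measurableSet] at h0
    exact measure_mono_null (subset_preimage_image h _) h0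
  calc η (h ⁻¹' (h '' F)) ≤ η (F ∪ ⋃ k, G k) := measure_mono hsub
    _ ≤ η F + η (⋃ k, G k) := measure_union_le _ _
    _ = η F := by rw [measure_iUnion_null hnull, add_zero]

lemma lift_unique {h : X → X} (hh : Continuous h) {μ : Measure X} [IsProbabilityMeasure μ] (H3 : HypH3 h μ)
    (η η' : Measure X) [IsProbabilityMeasure η] [IsProbabilityMeasure η'] (hη : η.map h = μ) (hη' : η'.map h = μ) :
    η = η' := by
  refine ext_of_generate_finite _ (BorelSpace.measurable_eq.trans borel_eq_generateFrom_isClosed) isPiSystem_isClosed ?_ (by simp)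
  intro F hF
  rw [lift_closed hh H3 η hη hF, lift_closed hh H3 η' hη' hF]

lemma exists_nu [Nonempty X] {f : X ≃ₜ X} (D : BD f) {h : X → X} (hh : Continuous h)
    {μ : Measure X} [IsProbabilityMeasure μ] (hμ : WeakLimit (perMeasure f) μ) (H3 : HypH3 h μ)
    (μs : ℕ → Measure X) (hp : ∀ᶠ n in atTop, IsProbabilityMeasure (μs n))
    (hm : ∀ᶠ n in atTop, (μs n).map h = perMeasure f n) :
    ∃ ν : Measure X, IsProbabilityMeasure ν ∧ WeakLimit μs ν ∧ ν.map h = μ := by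
  obtain ⟨p, hpe⟩ := exists_seq_prob μs μ hp
  obtain ⟨p', hpe', ht'⟩ := weak_prob (per_prob D) hμ
  let Φ : ProbabilityMeasure X → ProbabilityMeasure X := fun q => q.map hh.measurable.aemeasurable
  have hΦ : Continuous Φ := ProbabilityMeasure.continuous_map hh
  have hΦt : Tendsto (Φ ∘ p) atTop (𝓝 (mkP μ)) := by
    refine ht'.congr' ?_
    filter_upwards [hpe, hpe', hm] with n h1 h2 h3
    apply Subtype.ext
    show (p' n : Measure X) = (p n : Measure X).map h
    rw [h1, h2, h3]
  have key : ∀ q : ProbabilityMeasure X, MapClusterPt q atTop p → (q : Measure X).map h = μ := by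
    intro q hq
    have h1 : MapClusterPt (Φ q) atTop (Φ ∘ p) := hq.continuousAt_comp hΦ.continuousAt
    have h2 : ClusterPt (Φ q) (𝓝 (mkP μ)) := ClusterPt.mono h1 hΦt
    have h3 : Φ q = mkP μ := by
      have := h2
      exact eq_of_nhds_neBot this
    exact congrArg (fun r : ProbabilityMeasure X => (r : Measure X)) h3
  obtain ⟨q, hq⟩ := exists_clusterPt_of_compactSpace (map p atTop)
  have hqt : Tendsto p atTop (𝓝 q) := by
    refine tendsto_nhds_of_unique_mapClusterPt (fun r hr => ?_)
    have hrq : (r : Measure X) = (q : Measure X) :=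
      lift_unique hh H3 (r : Measure X) (q : Measure X) (key r hr) (key q hq)
    exact Subtype.ext hrq
  refine ⟨q, inferInstance, ?_, key q hq⟩
  intro φ
  rw [ProbabilityMeasure.tendsto_iff_forall_integral_tendsto] at hqt
  refine (hqt (BoundedContinuousFunction.mkOfCompact φ)).congr' ?_
  filter_upwards [hpe] with n hn
  rw [hn]; rfl

lemma nu_ergodic {f g : X ≃ₜ X} {h : X → X} (hh : Continuous h) (hsemi : ∀ x, f (h x) = h (g x))
    {μ : Measure X} [IsProbabilityMeasure μ] (hμ : Ergodic f μ) (H3 : HypH3 h μ)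
    (ν : Measure X) [IsProbabilityMeasure ν] (hν : ν.map h = μ) (hi : ν.map g = ν) : Ergodic g ν := by
  have hgm : Measurable g := g.continuous.measurable
  have hfm : Measurable f := f.continuous.measurable
  refine { measurable := hgm, map_eq := hi, aeconst_set := ?_ }
  intro A hA hAi
  rw [eventuallyConst_set']
  by_cases hA0 : ν A = 0
  · left; exact ae_eq_empty.2 hA0
  right
  rw [ae_eq_univ]
  have ip : IsProbabilityMeasure (ProbabilityTheory.cond ν A) := ProbabilityTheory.cond_isProbabilityMeasure hA0
  have hci : (ProbabilityTheory.cond ν A).map g = ProbabilityTheory.cond ν A := by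
    ext B hB
    rw [Measure.map_apply hgm hB, ProbabilityTheory.cond_apply hA, ProbabilityTheory.cond_apply hA]
    congr 1
    conv_rhs => rw [← hi, Measure.map_apply hgm (hA.inter hB), preimage_inter, hAi]
  have ip2 : IsProbabilityMeasure ((ProbabilityTheory.cond ν A).map h) :=
    Measure.isProbabilityMeasure_map hh.measurable.aemeasurable
  have hmap : (ProbabilityTheory.cond ν A).map h = μ := by
    refine hμ.eq_of_absolutelyContinuous ⟨hfm, ?_⟩ ?_
    · rw [Measure.map_map hfm hh.measurable, show f ∘ h = h ∘ g from funext hsemi,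
        ← Measure.map_map hh.measurable hgm, hci]
    · rw [← hν]
      exact (ProbabilityTheory.cond_absolutelyContinuous).map hh.measurable
  have heq := lift_unique hh H3 _ _ hmap hν
  rw [← heq, ProbabilityTheory.cond_apply hA]
  simp

lemma nu_entropy [Nonempty X] {f g : X ≃ₜ X} (D : BD f) {h : X → X} (hh : Continuous h) (hsemi : ∀ x, f (h x) = h (g x))
    {μ : Measure X} [IsProbabilityMeasure μ] (hμ : WeakLimit (perMeasure f) μ)
    (ν : Measure X) [IsProbabilityMeasure ν] (hν : ν.map h = μ) : (D.H : EReal) ≤ mEntropy g ν := by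
  obtain ⟨E, a, ha, hE⟩ := exists_gen D hμ
  refine le_mEntropy ν g g.continuous.measurable D.H (ha.compMeas hh.measurable) ?_
  intro n hn
  refine (hE n hn).trans_eq ?_
  have : nm g (a ∘ h) n = nm f a n ∘ h := by
    funext x i
    show a (h (g^[i.1] x)) = a (f^[i.1] (h x))
    rw [(show Function.Semiconj h g f from fun x => (hsemi x).symm).iterate_right i.1 x]
  unfold DH
  rw [this, Hf_comp_mp ν hh.measurable (ha.nm f.continuous.measurable n), hν]

end
end SamvaAux

/-- **Main Theorem.** Under (H1), (H2), (H3), the sequence `ν_n` converges weakly to a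
probability measure `ν` which is `g`-invariant, ergodic, and is the unique measure
maximizing the entropy of `g`. -/
theorem main_theorem
    {X : Type*} [MetricSpace X] [CompactSpace X] [MeasurableSpace X] [BorelSpace X]
    (f g : X ≃ₜ X) (h : X → X) (hcont : Continuous h) (hsurj : Function.Surjective h)
    (hsemi : ∀ x : X, f (h x) = h (g x))
    (hexp : IsExpansive f) (hspec : HasSpecification f)
    (μ : Measure X) (hμprob : IsProbabilityMeasure μ)
    (hμ : WeakLimit (perMeasure (⇑f)) μ)
    (H1 : HypH1 (⇑g) h) (H2 : HypH2 (⇑f) (⇑g) h) (H3 : HypH3 h μ)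
    (P : ℕ → Set X) (hP : IsPerSelection (⇑f) (⇑g) h P)
 :
    ∃ ν : Measure X,
      WeakLimit (fun n => unifMeasure (P n)) ν ∧
      IsProbabilityMeasure ν ∧
      Measure.map (⇑g) ν = ν ∧
      Ergodic (⇑g) ν ∧
      mEntropy (⇑g) ν = topEntropy (⇑g) ∧
      ∀ η : Measure X, IsProbabilityMeasure η → Measure.map (⇑g) η = η →
        mEntropy (⇑g) η = topEntropy (⇑g) → η = ν := by
  have hne : Nonempty X := nonempty_of_isProbabilityMeasure μ
  obtain ⟨D⟩ := SamvaAux.exists_BD f hexp hspec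
  have hgm : Measurable g := g.continuous.measurable
  have hfm : Measurable f := f.continuous.measurable
  have hfin : ∀ n, 1 ≤ n → (P n).Finite := fun n hn => by
    obtain ⟨-, -, hb⟩ := hP n
    exact Set.Finite.of_finite_image (hb.image_eq ▸ SamvaAux.per_fin D hn) hb.injOn
  have hprob : ∀ᶠ n in atTop, IsProbabilityMeasure (unifMeasure (P n)) := by
    filter_upwards [eventually_ge_atTop (3 * D.M), eventually_ge_atTop 1] with n h1 h2
    refine ProbabilityTheory.isProbabilityMeasure_uniformOn (hfin n h2) ?_
    have := SamvaAux.per_ne D h1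
    rw [← (hP n).2.2.image_eq] at this
    exact this.of_image
  have hmap : ∀ᶠ n in atTop, (unifMeasure (P n)).map h = perMeasure f n := by
    filter_upwards [eventually_ge_atTop 1] with n h2
    unfold unifMeasure perMeasure
    rw [SamvaAux.unif_map (hfin n h2) hcont.measurable (hP n).2.2.injOn, (hP n).2.2.image_eq]
  obtain ⟨ν, hνp, hw, hν⟩ := SamvaAux.exists_nu D hcont hμ H3 _ hprob hmap
  have hνi : ν.map g = ν := by
    refine SamvaAux.weak_inv g hw ?_
    filter_upwards [eventually_ge_atTop 1] with n h2
    exact SamvaAux.unif_inv (hfin n h2) g (hP n).2.1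
  have htop : topEntropy g = D.H := SamvaAux.topEntropy_g D hcont hsurj hsemi H1
  have hinvmap : ∀ η : Measure X, η.map g = η → (η.map h).map f = η.map h := by
    intro η hη
    rw [Measure.map_map hfm hcont.measurable, show f ∘ h = h ∘ g from funext hsemi,
      ← Measure.map_map hcont.measurable hgm, hη]
  refine ⟨ν, hw, hνp, hνi, SamvaAux.nu_ergodic hcont hsemi (SamvaAux.mu_ergodic D hμ) H3 ν hν hνi, ?_, ?_⟩
  · rw [htop]
    refine le_antisymm ?_ (SamvaAux.nu_entropy D hcont hsemi hμ ν hν)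
    refine SamvaAux.mEntropy_lift hcont hsurj hsemi H1 ν hνi D.H ?_
    rw [hν]
    exact SamvaAux.mEntropy_le_H D μ (SamvaAux.mu_inv D hμ)
  · intro η hηp hηi hηe
    have i2 : IsProbabilityMeasure (η.map h) := Measure.isProbabilityMeasure_map hcont.measurable.aemeasurable
    have hη : η.map h = μ := by
      refine SamvaAux.mme_unique D hμ (η.map h) (hinvmap η hηi) ?_
      by_contra hcon
      push Not at hcon
      obtain ⟨c, hc1, hc2⟩ := EReal.lt_iff_exists_real_btwn.1 hcon
      have := SamvaAux.mEntropy_lift hcont hsurj hsemi H1 η hηi c hc1.le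
      rw [hηe, htop] at this
      exact absurd hc2 (not_lt.2 this)
    exact SamvaAux.lift_unique hcont H3 η ν hη hν
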